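/- arXiv:1605.01349 — 6 statements merged into one kernel-verified Lean document; each statement's English description precedes it below -/
import Mathlib

section
/- Fix q, s, u₁, u₂ ∈ ℂ with s·u₁ ≠ 1 and s·u₂ ≠ 1. For m, n ∈ ℤ≥0 let w^{(m,n)}_{u₁,u₂} and w̃^{(m,n)}_{u₁,u₂} be the 4×4 two-vertex weight matrices and let X be the 4×4 matrix X = [[u₁−qu₂, 0, 0, 0], [0, q(u₁−u₂), (1−q)u₁, 0], [0, (1−q)u₂, u₁−u₂, 0], [0, 0, 0, u₁−qu₂]]. Then for every m, n ∈ ℤ≥0 the Yang–Baxter equation holds in the form w̃^{(m,n)}_{u₂,u₁} · X = X · w^{(m,n)}_{u₁,u₂} (equivalently w̃^{(m,n)}_{u₂,u₁} = X · w^{(m,n)}_{u₁,u₂} · X^{−1} whenever X is invertible). -/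
noncomputable section

/-- Higher spin six vertex weights `w_u(i₁,j₁;i₂,j₂)`. -/
def wt (q s u : ℂ) (i1 j1 i2 j2 : ℕ) : ℂ :=
  if j1 = 0 ∧ j2 = 0 ∧ i2 = i1 then (1 - s * q ^ i1 * u) / (1 - s * u)
  else if j1 = 0 ∧ j2 = 1 ∧ i1 = i2 + 1 then (1 - s ^ 2 * q ^ i2) * u / (1 - s * u)
  else if j1 = 1 ∧ j2 = 1 ∧ i2 = i1 then (u - s * q ^ i1) / (1 - s * u)
  else if j1 = 1 ∧ j2 = 0 ∧ i2 = i1 + 1 then (1 - q ^ (i1 + 1)) / (1 - s * u)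
  else 0

/-- Two-vertex weights `w^{(m,n)}_{u₁,u₂}(k₁,k₂;k₁′,k₂′) = Σ_{l≥0} w_{u₁}(m,k₁;l,k₁′)·w_{u₂}(l,k₂;n,k₂′)`
(the summand vanishes unless `l + k₁′ = m + k₁`, so the finite range below captures the full sum). -/
def w2 (q s u1 u2 : ℂ) (m n k1 k2 k1' k2' : ℕ) : ℂ :=
  ∑ l ∈ Finset.range (m + k1 + 1), wt q s u1 m k1 l k1' * wt q s u2 l k2 n k2'

/-- The 4×4 matrix of two-vertex weights, rows indexed by `(k₁,k₂)` and columns by `(k₁′,k₂′)`. -/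
def wMat (q s u1 u2 : ℂ) (m n : ℕ) : Matrix (Fin 2 × Fin 2) (Fin 2 × Fin 2) ℂ :=
  fun p p' => w2 q s u1 u2 m n (p.1 : ℕ) (p.2 : ℕ) (p'.1 : ℕ) (p'.2 : ℕ)

/-- The 4×4 matrix of the weights `w̃`, with the two horizontal arrows swapped. -/
def wtildeMat (q s u1 u2 : ℂ) (m n : ℕ) : Matrix (Fin 2 × Fin 2) (Fin 2 × Fin 2) ℂ :=
  fun p p' => w2 q s u1 u2 m n (p.2 : ℕ) (p.1 : ℕ) (p'.2 : ℕ) (p'.1 : ℕ)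

/-- The conjugating matrix `X` of the Yang–Baxter equation. -/
def Xmat (q u1 u2 : ℂ) : Matrix (Fin 2 × Fin 2) (Fin 2 × Fin 2) ℂ :=
  fun p p' =>
    if p = ((0 : Fin 2), (0 : Fin 2)) ∧ p' = ((0 : Fin 2), (0 : Fin 2)) then u1 - q * u2
    else if p = ((0 : Fin 2), (1 : Fin 2)) ∧ p' = ((0 : Fin 2), (1 : Fin 2)) then q * (u1 - u2)
    else if p = ((0 : Fin 2), (1 : Fin 2)) ∧ p' = ((1 : Fin 2), (0 : Fin 2)) then (1 - q) * u1
    else if p = ((1 : Fin 2), (0 : Fin 2)) ∧ p' = ((0 : Fin 2), (1 : Fin 2)) then (1 - q) * u2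
    else if p = ((1 : Fin 2), (0 : Fin 2)) ∧ p' = ((1 : Fin 2), (0 : Fin 2)) then u1 - u2
    else if p = ((1 : Fin 2), (1 : Fin 2)) ∧ p' = ((1 : Fin 2), (1 : Fin 2)) then u1 - q * u2
    else 0

theorem wt_eq_zero (q s u : ℂ) {i1 j1 i2 j2 : ℕ} (h : i1 + j1 ≠ i2 + j2) :
    wt q s u i1 j1 i2 j2 = 0 := by
  unfold wt
  split_ifs <;> first | rfl | omega

/-- Arrow conservation leaves a single term in the sum defining the two-vertex weight. -/
theorem w2_eq_of_add_eq (q s u1 u2 : ℂ) {m k1 l k1' : ℕ} (n k2 k2' : ℕ)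
    (h : m + k1 = l + k1') :
    w2 q s u1 u2 m n k1 k2 k1' k2' = wt q s u1 m k1 l k1' * wt q s u2 l k2 n k2' := by
  unfold w2
  refine Finset.sum_eq_single_of_mem l (Finset.mem_range.2 (by omega)) fun b _ hb => ?_
  rw [wt_eq_zero q s u1 (by omega), zero_mul]

theorem w2_zero_zero (q s u1 u2 : ℂ) (m n k2 k2' : ℕ) :
    w2 q s u1 u2 m n 0 k2 0 k2' = wt q s u1 m 0 m 0 * wt q s u2 m k2 n k2' :=
  w2_eq_of_add_eq q s u1 u2 n k2 k2' rfl

theorem w2_one_zero (q s u1 u2 : ℂ) (m n k2 k2' : ℕ) :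
    w2 q s u1 u2 m n 1 k2 0 k2' = wt q s u1 m 1 (m + 1) 0 * wt q s u2 (m + 1) k2 n k2' :=
  w2_eq_of_add_eq q s u1 u2 n k2 k2' rfl

theorem w2_one_one (q s u1 u2 : ℂ) (m n k2 k2' : ℕ) :
    w2 q s u1 u2 m n 1 k2 1 k2' = wt q s u1 m 1 m 1 * wt q s u2 m k2 n k2' :=
  w2_eq_of_add_eq q s u1 u2 n k2 k2' rfl

/-- For `m = 0` both sides vanish. -/
theorem w2_zero_one (q s u1 u2 : ℂ) (m n k2 k2' : ℕ) :
    w2 q s u1 u2 m n 0 k2 1 k2' = wt q s u1 m 0 (m - 1) 1 * wt q s u2 (m - 1) k2 n k2' := by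
  rcases m with _ | m
  · rw [wt_eq_zero q s u1 (by omega), zero_mul]
    exact Finset.sum_eq_zero fun l _ => by rw [wt_eq_zero q s u1 (by omega), zero_mul]
  · exact w2_eq_of_add_eq q s u1 u2 n k2 k2' rfl

theorem w2_eq_zero (q s u1 u2 : ℂ) {m n k1 k2 k1' k2' : ℕ}
    (h : m + k1 + k2 ≠ n + k1' + k2') :
    w2 q s u1 u2 m n k1 k2 k1' k2' = 0 := by
  refine Finset.sum_eq_zero fun l _ => ?_
  by_cases hl : m + k1 = l + k1'
  · rw [wt_eq_zero q s u2 (by omega), mul_zero]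
  · rw [wt_eq_zero q s u1 hl, zero_mul]

/-- The Yang–Baxter equation: `w̃^{(m,n)}_{u₂,u₁} · X = X · w^{(m,n)}_{u₁,u₂}`. -/
theorem yang_baxter (q s u1 u2 : ℂ) (h1 : s * u1 ≠ 1) (h2 : s * u2 ≠ 1) (m n : ℕ) :
    wtildeMat q s u2 u1 m n * Xmat q u1 u2 = Xmat q u1 u2 * wMat q s u1 u2 m n := by
  have d1 : 1 - s * u1 ≠ 0 := sub_ne_zero.2 h1.symm
  have d2 : 1 - s * u2 ≠ 0 := sub_ne_zero.2 h2.symm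
  have d1' : 1 - u1 * s ≠ 0 := by rwa [mul_comm]
  have d2' : 1 - u2 * s ≠ 0 := by rwa [mul_comm]
  ext ⟨a, b⟩ ⟨c, d⟩
  by_cases hn : m + a + b = n + c + d
  · rcases m with _ | _ | m <;> fin_cases a <;> fin_cases b <;> fin_cases c <;> fin_cases d <;>
      simp at hn <;> (try subst hn) <;>
      simp [Matrix.mul_apply, Fintype.sum_prod_type, wtildeMat, wMat, Xmat, w2_zero_zero,
        w2_zero_one, w2_one_zero, w2_one_one, wt] <;>
      (try field_simp) <;> (try ring1)
  · fin_cases a <;> fin_cases b <;> fin_cases c <;> fin_cases d <;>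
      simp at hn <;>
      simp (disch := omega) [Matrix.mul_apply, Fintype.sum_prod_type, wtildeMat, wMat, Xmat,
        w2_eq_zero]

end
end

section
/- Let q ∈ (0,1), s ∈ ℂ, M ∈ ℤ≥1, u ∈ ℂ∖{0} with s·q^{i−1}·u ≠ 1 for i = 1,…,M. Then for any μ ∈ Sign⁺_M, the principal specialization of the symmetric rational function F_μ at the geometric sequence (u, qu, …, q^{M−1}u) is given by F_μ(u, qu, …, q^{M−1}u) = (q;q)_M/(su;q)_M · ∏_{i=1}^M ((q^{i−1}u − s)/(1 − s q^{i−1} u))^{μ_i}. -/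
open Finset

noncomputable section

/-- The finite q-Pochhammer symbol `(a;q)_m = ∏_{i=0}^{m-1} (1 - a q^i)`. -/
def qPoch {K : Type*} [CommRing K] (a q : K) (m : ℕ) : K :=
  ∏ i ∈ Finset.range m, (1 - a * q ^ i)

/-- Signatures of length `n`: weakly decreasing tuples of nonnegative integers. -/
abbrev Sign (n : ℕ) : Type :=
  {ν : Fin n → ℕ // ∀ i j : Fin n, i ≤ j → ν j ≤ ν i}

/-- The symmetric rational function `F_μ(u₁,…,u_M)` (symmetrization formula (4.20)). -/
def Ffun (q s : ℂ) {M : ℕ} (μ : Fin M → ℕ) (u : Fin M → ℂ) : ℂ :=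
  ((1 - q) ^ M / ∏ i, (1 - s * u i)) *
    ∑ σ : Equiv.Perm (Fin M),
      (∏ p ∈ (Finset.univ : Finset (Fin M × Fin M)).filter (fun p => p.1 < p.2),
        (u (σ p.1) - q * u (σ p.2)) / (u (σ p.1) - u (σ p.2))) *
      ∏ i, ((u (σ i) - s) / (1 - s * u (σ i))) ^ (μ i)

/-- A permutation of `Fin (n + 1)` whose inverse increases at every step is the identity. -/
theorem Equiv.Perm.eq_one_of_symm_castSucc_lt_symm_succ {n : ℕ} (σ : Equiv.Perm (Fin (n + 1)))
    (h : ∀ i : Fin n, σ.symm i.castSucc < σ.symm i.succ) : σ = 1 := by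
  have hmono : StrictMono σ.symm := Fin.strictMono_iff_lt_succ.2 h
  have hid : (σ.symm : Fin (n + 1) → Fin (n + 1)) = id :=
    (hmono.range_inj strictMono_id).1 (by simp)
  ext i
  have := congrFun hid (σ i)
  simp only [Equiv.symm_apply_apply, id] at this
  simp [← this]

/-- For fixed `b`, the cross factors of the identity permutation along a geometric sequence
telescope. -/
theorem prod_range_geometric_cross_factor {K : Type*} [Field K] {q u : K} (hq : q ≠ 0)
    (hroot : ∀ k : ℕ, q ^ (k + 1) ≠ 1) (hu : u ≠ 0) (b : ℕ) :
    ∏ a ∈ Finset.range b, (q ^ a * u - q * (q ^ b * u)) / (q ^ a * u - q ^ b * u)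
      = (1 - q ^ (b + 1)) / (1 - q) := by
  have hne (k : ℕ) : 1 - q ^ (k + 1) ≠ 0 := sub_ne_zero.2 (hroot k).symm
  rw [← Finset.prod_range_reflect]
  have hterm : ∀ d ∈ Finset.range b,
      (q ^ (b - 1 - d) * u - q * (q ^ b * u)) / (q ^ (b - 1 - d) * u - q ^ b * u)
        = (1 - q ^ (d + 1 + 1)) / (1 - q ^ (d + 1)) := by
    intro d hd
    obtain ⟨c, rfl⟩ : ∃ c, b = c + d + 1 :=
      ⟨b - d - 1, by have := Finset.mem_range.1 hd; omega⟩
    have hc : c + d + 1 - 1 - d = c := by omega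
    rw [hc, ← mul_div_mul_left (1 - q ^ (d + 1 + 1)) _ (mul_ne_zero (pow_ne_zero c hq) hu)]
    congr 1 <;> ring
  rw [Finset.prod_congr rfl hterm]
  clear hterm
  induction b with
  | zero => simpa using (div_self (by simpa using hne 0)).symm
  | succ b ih =>
    rw [Finset.prod_range_succ, ih, div_mul_div_comm, mul_comm (1 - q),
      mul_div_mul_left _ _ (hne b)]

/-- The product of all cross factors of the identity permutation along a geometric sequence. -/
theorem prod_geometric_cross_factor {K : Type*} [Field K] {q u : K} (hq : q ≠ 0)
    (hroot : ∀ k : ℕ, q ^ (k + 1) ≠ 1) (hu : u ≠ 0) (M : ℕ) :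
    ∏ p ∈ (Finset.univ : Finset (Fin M × Fin M)).filter (fun p => p.1 < p.2),
        (q ^ (p.1 : ℕ) * u - q * (q ^ (p.2 : ℕ) * u)) /
          (q ^ (p.1 : ℕ) * u - q ^ (p.2 : ℕ) * u)
      = qPoch q q M / (1 - q) ^ M := by
  rw [Finset.prod_filter, Fintype.prod_prod_type_right]
  have hinner (b : Fin M) :
      ∏ a : Fin M, (if a < b then
        (q ^ (a : ℕ) * u - q * (q ^ (b : ℕ) * u)) / (q ^ (a : ℕ) * u - q ^ (b : ℕ) * u) else 1)
        = (1 - q ^ ((b : ℕ) + 1)) / (1 - q) := by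
    rw [← prod_range_geometric_cross_factor hq hroot hu]
    simp only [Fin.lt_def]
    rw [Fin.prod_univ_eq_prod_range (fun a => if a < (b : ℕ) then
      (q ^ a * u - q * (q ^ (b : ℕ) * u)) / (q ^ a * u - q ^ (b : ℕ) * u) else 1),
      ← Finset.prod_filter]
    congr 1
    ext a
    have := b.2
    simp only [Finset.mem_filter, Finset.mem_range]
    omega
  rw [Finset.prod_congr rfl fun b _ => hinner b,
    Fin.prod_univ_eq_prod_range (fun b => (1 - q ^ (b + 1)) / (1 - q)), Finset.prod_div_distrib]
  simp [qPoch, pow_succ']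

/-- Every permutation other than the identity has a vanishing cross factor along a geometric
sequence of ratio `q`. -/
theorem prod_geometric_cross_factor_perm_eq_zero {K : Type*} [Field K] (q u : K) {M : ℕ}
    {σ : Equiv.Perm (Fin M)} (hσ : σ ≠ 1) :
    ∏ p ∈ (Finset.univ : Finset (Fin M × Fin M)).filter (fun p => p.1 < p.2),
        (q ^ (σ p.1 : ℕ) * u - q * (q ^ (σ p.2 : ℕ) * u)) /
          (q ^ (σ p.1 : ℕ) * u - q ^ (σ p.2 : ℕ) * u) = 0 := by
  cases M with
  | zero => exact absurd (Subsingleton.elim σ 1) hσ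
  | succ n =>
    obtain ⟨i, hi⟩ : ∃ i : Fin n, σ.symm i.succ ≤ σ.symm i.castSucc := by
      by_contra! h
      exact hσ (σ.eq_one_of_symm_castSucc_lt_symm_succ h)
    have hlt : σ.symm i.succ < σ.symm i.castSucc :=
      lt_of_le_of_ne hi fun h => i.castSucc_lt_succ.ne' (σ.symm.injective h)
    refine Finset.prod_eq_zero (i := (σ.symm i.succ, σ.symm i.castSucc)) (by simpa using hlt) ?_
    simp [pow_succ', mul_assoc]

/-- Principal specialization of `F_μ` at the geometric sequence `(u, qu, …, q^{M-1}u)`. -/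
theorem F_principal_specialization (q : ℝ) (hq : q ∈ Set.Ioo (0 : ℝ) 1) (s : ℂ)
    (M : ℕ) (hM : 1 ≤ M) (u : ℂ) (hu : u ≠ 0)
    (hsu : ∀ i : Fin M, s * (q : ℂ) ^ (i : ℕ) * u ≠ 1) (μ : Sign M) :
    Ffun (q : ℂ) s μ.1 (fun i => (q : ℂ) ^ (i : ℕ) * u)
      = qPoch (q : ℂ) (q : ℂ) M / qPoch (s * u) (q : ℂ) M *
          ∏ i : Fin M, (((q : ℂ) ^ (i : ℕ) * u - s) / (1 - s * (q : ℂ) ^ (i : ℕ) * u)) ^ (μ.1 i) := by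
  have hq0 : (q : ℂ) ≠ 0 := by exact_mod_cast hq.1.ne'
  have hroot (k : ℕ) : (q : ℂ) ^ (k + 1) ≠ 1 := by
    exact_mod_cast (pow_lt_one₀ hq.1.le hq.2 k.succ_ne_zero).ne
  have h1q : (1 - (q : ℂ)) ^ M ≠ 0 :=
    pow_ne_zero _ (sub_ne_zero.2 (by simpa using (hroot 0).symm))
  have hden : ∏ i : Fin M, (1 - s * ((q : ℂ) ^ (i : ℕ) * u)) = qPoch (s * u) (q : ℂ) M := by
    rw [Fin.prod_univ_eq_prod_range (fun i => 1 - s * ((q : ℂ) ^ i * u)), qPoch]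
    exact Finset.prod_congr rfl fun i _ => by ring
  unfold Ffun
  rw [Finset.sum_eq_single 1
    (fun σ _ hσ => by rw [prod_geometric_cross_factor_perm_eq_zero _ _ hσ, zero_mul]) (by simp)]
  simp only [Equiv.Perm.coe_one, id]
  rw [prod_geometric_cross_factor hq0 hroot hu, hden, ← mul_assoc]
  simp only [← mul_assoc]
  congr 1
  field_simp

end
end

section
/- Let q ∈ (0,1), s ∈ ℂ, n ∈ ℤ≥0, and let ν ∈ Sign⁺_n have exactly k zero parts. Let N ≥ n−k and v ∈ ℂ∖{0} be such that s·q^{j−1}·v ≠ 1 for 1 ≤ j ≤ max(n,N), q^{j−1}v ≠ s for 1 ≤ j ≤ N, and (s²;q)_k ≠ 0. Then the principal specialization of G_ν at the geometric sequence (v, qv, …, q^{N−1}v) equals G_ν(v, qv, …, q^{N−1}v) = (q;q)_N/(q;q)_{N−n+k} · (sv;q)_{N+k}/((sv;q)_n·(sv;q)_N) · (s²;q)_n/(s²;q)_k · 1/(s/v; q^{−1})_{n−k} · ∏_{j=1}^N ((q^{j−1}v − s)/(1 − s q^{j−1} v))^{ν_j}, where ν_j := 0 for j > n and (a;q^{−1})_m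 = ∏_{i=0}^{m−1}(1 − a q^{−i}). -/
open Finset

noncomputable section

/-- Multiplicity of the value `k` among the parts of `lam`. -/
def mult {n : ℕ} (lam : Fin n → ℕ) (k : ℕ) : ℕ :=
  ((Finset.univ : Finset (Fin n)).filter (fun i => lam i = k)).card

/-- The conjugation constant `c(λ) = ∏_{k≥0} (s²;q)_{m_k}/(q;q)_{m_k}`. -/
def cconst (q s : ℂ) {n : ℕ} (lam : Fin n → ℕ) : ℂ :=
  ∏ᶠ k : ℕ, qPoch (s ^ 2) q (mult lam k) / qPoch q q (mult lam k)

/-- `F^c_λ = c(λ)·F_λ`. -/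
def Fc (q s : ℂ) {M : ℕ} (μ : Fin M → ℕ) (u : Fin M → ℂ) : ℂ :=
  cconst q s μ * Ffun q s μ u

/-- The symmetric rational function `G_ν(v₁,…,v_N)` (symmetrization formula (4.21)). -/
def Gfun (q s : ℂ) {n N : ℕ} (ν : Fin n → ℕ) (v : Fin N → ℂ) : ℂ :=
  if h : n - mult ν 0 ≤ N then
    (qPoch (s ^ 2) q n / (qPoch q q (N - (n - mult ν 0)) * qPoch (s ^ 2) q (mult ν 0))) *
      ((1 - q) ^ N / ∏ j, (1 - s * v j)) *
      ∑ σ : Equiv.Perm (Fin N),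
        (∏ p ∈ (Finset.univ : Finset (Fin N × Fin N)).filter (fun p => p.1 < p.2),
          (v (σ p.1) - q * v (σ p.2)) / (v (σ p.1) - v (σ p.2))) *
        (∏ j : Fin (n - mult ν 0),
          ((v (σ (Fin.castLE h j)) - s) / (1 - s * v (σ (Fin.castLE h j)))) ^
            (ν (Fin.castLE (Nat.sub_le n (mult ν 0)) j))) *
        (∏ i : Fin (n - mult ν 0), v (σ (Fin.castLE h i)) / (v (σ (Fin.castLE h i)) - s)) *
        (∏ j ∈ (Finset.univ : Finset (Fin N)).filter (fun j : Fin N => n - mult ν 0 ≤ (j : ℕ)),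
          (1 - s * q ^ (mult ν 0) * v (σ j)))
  else 0

/-- A permutation of `Fin N` other than the identity puts some value `i + 1` before `i`. -/
theorem exists_lt_apply_eq_succ {N : ℕ} (σ : Equiv.Perm (Fin N)) (hσ : σ ≠ 1) :
    ∃ a b : Fin N, a < b ∧ (σ a : ℕ) = σ b + 1 := by
  by_contra! H
  apply hσ
  cases N with
  | zero => exact Subsingleton.elim _ _
  | succ N =>
    have hmono : StrictMono ⇑σ.symm := by
      rw [Fin.strictMono_iff_lt_succ]
      intro i
      by_contra! hle
      have hne : σ.symm i.succ ≠ σ.symm i.castSucc := fun h => by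
        simpa [Fin.ext_iff] using σ.symm.injective h
      exact H _ _ (lt_of_le_of_ne hle hne) (by simp)
    ext i
    have := congrFun hmono.eq_id (σ i)
    rw [Equiv.symm_apply_apply, id] at this
    simp [← this]

/-- Telescoping product over `a < b < N` of the Hall–Littlewood weights at a geometric sequence. -/
theorem prod_range_geom_ratio {q v : ℂ} (hq0 : q ≠ 0) (hq1 : ∀ d : ℕ, q ^ (d + 1) ≠ 1)
    (hv : v ≠ 0) (N : ℕ) :
    ∏ a ∈ range N, ∏ b ∈ range N,
      (if a < b then (q ^ a * v - q * (q ^ b * v)) / (q ^ a * v - q ^ b * v) else 1)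
      = qPoch q q N / (1 - q) ^ N := by
  have hsub : ∀ d : ℕ, 1 - q ^ (d + 1) ≠ 0 := fun d => sub_ne_zero.2 (hq1 d).symm
  have hone : 1 - q ≠ 0 := by simpa using hsub 0
  induction N with
  | zero => simp [qPoch]
  | succ N ih =>
    have hlast : ∏ b ∈ range (N + 1),
        (if N < b then (q ^ N * v - q * (q ^ b * v)) / (q ^ N * v - q ^ b * v) else 1) = 1 :=
      prod_eq_one fun b hb => if_neg (by simp at hb; omega)
    have hcol : ∏ a ∈ range N,
        (if a < N then (q ^ a * v - q * (q ^ N * v)) / (q ^ a * v - q ^ N * v) else 1)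
        = (1 - q * q ^ N) / (1 - q) := by
      have htel : ∏ d ∈ range N, (1 - q ^ (d + 1 + 1)) / (1 - q ^ (d + 1))
          = (1 - q * q ^ N) / (1 - q) := by
        clear ih hlast
        induction N with
        | zero => simp [hone]
        | succ N ih =>
          rw [prod_range_succ, ih]
          have := hsub N
          rw [pow_succ'] at this
          rw [pow_succ' q (N + 1), pow_succ' q N]
          field_simp
      rw [← htel, ← prod_range_reflect]
      refine prod_congr rfl fun a ha => ?_
      have ha' := mem_range.1 ha
      rw [if_pos (by omega)]
      obtain ⟨c, rfl⟩ : ∃ c, N = a + 1 + c := ⟨N - (a + 1), by omega⟩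
      have e : a + 1 + c - 1 - a = c := by omega
      rw [e]
      have h := hsub a
      have e1 : q ^ c * v - q * (q ^ (a + 1 + c) * v) = (q ^ c * v) * (1 - q ^ (a + 1 + 1)) := by
        ring
      have e2 : q ^ c * v - q ^ (a + 1 + c) * v = (q ^ c * v) * (1 - q ^ (a + 1)) := by ring
      rw [e1, e2, mul_div_mul_left _ _ (by positivity)]
    rw [prod_range_succ, hlast, mul_one]
    simp_rw [prod_range_succ _ N]
    rw [prod_mul_distrib, ih, hcol, qPoch, qPoch, prod_range_succ, pow_succ,
      div_mul_div_comm]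

/-- At a geometric sequence, only the identity permutation contributes to a Hall–Littlewood
type symmetrization. -/
theorem sum_perm_geom {q v : ℂ} (hq0 : q ≠ 0) (hq1 : ∀ d : ℕ, q ^ (d + 1) ≠ 1) (hv : v ≠ 0)
    {N : ℕ} (f : Equiv.Perm (Fin N) → ℂ) :
    ∑ σ : Equiv.Perm (Fin N),
      (∏ p ∈ (Finset.univ : Finset (Fin N × Fin N)).filter (fun p => p.1 < p.2),
        (q ^ (σ p.1 : ℕ) * v - q * (q ^ (σ p.2 : ℕ) * v)) /
          (q ^ (σ p.1 : ℕ) * v - q ^ (σ p.2 : ℕ) * v)) * f σ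
      = qPoch q q N / (1 - q) ^ N * f 1 := by
  rw [Fintype.sum_eq_single 1]
  · congr 1
    rw [prod_filter, Fintype.prod_prod_type, ← prod_range_geom_ratio hq0 hq1 hv]
    simp only [Equiv.Perm.one_apply, Fin.lt_def, ← Fin.prod_univ_eq_prod_range]
  · intro σ hσ
    obtain ⟨a, b, hab, h⟩ := exists_lt_apply_eq_succ σ hσ
    refine mul_eq_zero_of_left (prod_eq_zero (i := (a, b)) (by simpa using hab) ?_) _
    rw [h]
    ring

theorem mult_le {n : ℕ} (ν : Fin n → ℕ) (k : ℕ) : mult ν k ≤ n :=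
  (card_filter_le _ _).trans (by simp)

/-- The zero parts of a signature are its last `mult ν 0` parts. -/
theorem Sign.eq_zero_of_le {n : ℕ} (ν : Sign n) (j : Fin n) (hj : n - mult ν.1 0 ≤ j) :
    ν.1 j = 0 := by
  by_contra h
  have hsub : (univ.filter fun i => ν.1 i = 0) ⊆ Ioi j := by
    intro i hi
    by_contra hij
    have := ν.2 i j (by simpa using hij)
    simp only [mem_filter, mem_univ, true_and] at hi
    omega
  have hcard := card_le_card hsub
  rw [Fin.card_Ioi] at hcard
  have : mult ν.1 0 = #(univ.filter fun i => ν.1 i = 0) := rfl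
  omega

theorem qPoch_add {K : Type*} [CommRing K] (a q : K) (m l : ℕ) :
    qPoch a q (m + l) = qPoch a q m * ∏ i ∈ range l, (1 - a * q ^ (m + i)) :=
  prod_range_add _ _ _

/-- Principal specialization of `G_ν` at the geometric sequence `(v, qv, …, q^{N-1}v)`,
where `ν` has exactly `k` zero parts and `ν_j := 0` for `j > n`. -/
theorem G_principal_specialization (q : ℝ) (hq : q ∈ Set.Ioo (0 : ℝ) 1) (s : ℂ)
    (n : ℕ) (ν : Sign n) (k N : ℕ) (hk : k = mult ν.1 0) (hN : n - k ≤ N)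
    (v : ℂ) (hv : v ≠ 0)
    (h1 : ∀ j < max n N, s * (q : ℂ) ^ j * v ≠ 1)
    (h2 : ∀ j < N, (q : ℂ) ^ j * v ≠ s)
    (h3 : qPoch (s ^ 2) (q : ℂ) k ≠ 0) :
    Gfun (q : ℂ) s ν.1 (fun j : Fin N => (q : ℂ) ^ (j : ℕ) * v)
      = qPoch (q : ℂ) (q : ℂ) N / qPoch (q : ℂ) (q : ℂ) (N - (n - k)) *
          (qPoch (s * v) (q : ℂ) (N + k) / (qPoch (s * v) (q : ℂ) n * qPoch (s * v) (q : ℂ) N)) *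
          (qPoch (s ^ 2) (q : ℂ) n / qPoch (s ^ 2) (q : ℂ) k) *
          (qPoch (s / v) ((q : ℂ))⁻¹ (n - k))⁻¹ *
          ∏ j ∈ Finset.range N,
            (((q : ℂ) ^ j * v - s) / (1 - s * (q : ℂ) ^ j * v)) ^
              (if h : j < n then ν.1 ⟨j, h⟩ else 0) := by
  subst hk
  have hq0 : (q : ℂ) ≠ 0 := by exact_mod_cast hq.1.ne'
  have hq1 : ∀ d : ℕ, (q : ℂ) ^ (d + 1) ≠ 1 := fun d => by
    exact_mod_cast (pow_lt_one₀ hq.1.le hq.2 d.succ_ne_zero).ne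
  have hone : 1 - (q : ℂ) ≠ 0 := by simpa using sub_ne_zero.2 (hq1 0).symm
  generalize (q : ℂ) = p at *
  have hkn := mult_le ν.1 0
  unfold Gfun
  rw [dif_pos hN]
  simp only [mul_assoc (∏ x ∈ univ.filter _, _)]
  rw [sum_perm_geom hq0 hq1 hv]
  simp only [Equiv.Perm.one_apply, Fin.val_castLE]
  obtain ⟨l, rfl⟩ : ∃ l, N = n - mult ν.1 0 + l := ⟨N - (n - mult ν.1 0), by omega⟩
  have hpow : ∏ j : Fin (n - mult ν.1 0), ((p ^ (j : ℕ) * v - s) / (1 - s * (p ^ (j : ℕ) * v))) ^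
        ν.1 (Fin.castLE (Nat.sub_le n (mult ν.1 0)) j)
      = ∏ j ∈ range (n - mult ν.1 0 + l), ((p ^ j * v - s) / (1 - s * p ^ j * v)) ^
        (if h : j < n then ν.1 ⟨j, h⟩ else 0) := by
    rw [prod_range_add, prod_eq_one (s := range l), mul_one, ← Fin.prod_univ_eq_prod_range]
    · refine prod_congr rfl fun j _ => ?_
      rw [dif_pos (by omega), mul_assoc s]
      rfl
    · intro j _
      split_ifs with h
      · rw [Sign.eq_zero_of_le ν _ (by simp), pow_zero]
      · exact pow_zero _
  rw [hpow]
  clear hpow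
  generalize mult ν.1 0 = k at *
  generalize hm : n - k = m at *
  obtain rfl : n = m + k := by omega
  have hpoch : ∀ M ≤ max (m + k) (m + l), qPoch (s * v) p M ≠ 0 := fun M hM =>
    prod_ne_zero_iff.2 fun j hj h =>
      h1 j ((mem_range.1 hj).trans_le hM) (by linear_combination -h)
  have hden : ∏ j : Fin (m + l), (1 - s * (p ^ (j : ℕ) * v)) = qPoch (s * v) p (m + l) := by
    rw [qPoch, ← Fin.prod_univ_eq_prod_range]
    exact prod_congr rfl fun j _ => by ring
  have hinv : ∏ i : Fin m, p ^ (i : ℕ) * v / (p ^ (i : ℕ) * v - s)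
      = (qPoch (s / v) p⁻¹ m)⁻¹ := by
    rw [qPoch, ← Fin.prod_univ_eq_prod_range, ← prod_inv_distrib]
    refine prod_congr rfl fun i _ => ?_
    have hp : p ^ (i : ℕ) ≠ 0 := pow_ne_zero _ hq0
    have h := sub_ne_zero.2 (h2 i (by omega))
    have e : 1 - s / v * p⁻¹ ^ (i : ℕ) = (p ^ (i : ℕ) * v - s) / (p ^ (i : ℕ) * v) := by
      rw [inv_pow]
      field_simp
    rw [e, inv_div]
  have htail : ∏ j ∈ (univ : Finset (Fin (m + l))).filter (fun j : Fin (m + l) => m ≤ (j : ℕ)),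
        (1 - s * p ^ k * (p ^ (j : ℕ) * v))
      = qPoch (s * v) p (m + l + k) / qPoch (s * v) p (m + k) := by
    rw [eq_div_iff (hpoch _ (le_max_left _ _)), add_right_comm, qPoch_add _ _ (m + k), mul_comm]
    congr 1
    rw [prod_filter, Fin.prod_univ_eq_prod_range
      (fun j => if m ≤ j then 1 - s * p ^ k * (p ^ j * v) else 1), prod_range_add,
      prod_eq_one fun j hj => if_neg (by simpa using hj), one_mul]
    refine prod_congr rfl fun j _ => ?_
    rw [if_pos (by omega)]
    ring
  have hN' := hpoch _ (le_max_right _ _)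
  rw [hden, hinv, htail]
  field_simp

end
end

section
/- Let q ∈ (0,1), s ∈ (−1,0), n ∈ ℤ≥0, and let ν ∈ Sign⁺_n have exactly k zero parts. For ε ∈ ℂ∖{0} (with all denominators below nonzero) define Φ_ν(ε) = (s²q^k;q)_{n−k} · (1;q)_k · ((sε)^{−1}q^{1+k−n};q)_{n−k} / ((s/ε;q^{−1})_{n−k} · (sε;q)_n) · ∏_{j=1}^{n−k} ((q^{j−1}ε − s)/(1 − s q^{j−1} ε))^{ν_j}; this is the principal specialization G_ν(ε, qε, …, q^{J−1}ε), regarded as a rational function of q^J and evaluated at q^J = 1/(sε). Then lim_{ε→0} Φ_ν(ε) = (−s)^{|ν|}·(s²;q)_n·s^{−2n} if ν_n > 0 (i.e., k = 0), and lim_{ε→0} Φ_ν(ε) = 0 if ν_n = 0 (i.e., k ≥ 1, in which case Φ_ν is identically 0 because (1;q)_k = 0). -/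
open Finset

noncomputable section

/-- The function `Φ_ν(ε)`: the principal specialization `G_ν(ε,qε,…,q^{J-1}ε)` regarded as a
rational function of `q^J` and evaluated at `q^J = 1/(sε)`, where `k` is the number of zero
parts of `ν`. -/
def Phi (q s : ℂ) {n : ℕ} (ν : Fin n → ℕ) (ε : ℂ) : ℂ :=
  (qPoch (s ^ 2 * q ^ (mult ν 0)) q (n - mult ν 0) * qPoch 1 q (mult ν 0) *
      qPoch ((s * ε)⁻¹ * q ^ ((1 : ℤ) + (mult ν 0 : ℤ) - (n : ℤ))) q (n - mult ν 0)) /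
    (qPoch (s / ε) q⁻¹ (n - mult ν 0) * qPoch (s * ε) q n) *
    ∏ j : Fin (n - mult ν 0),
      ((q ^ (j : ℕ) * ε - s) / (1 - s * q ^ (j : ℕ) * ε)) ^
        (ν (Fin.castLE (Nat.sub_le n (mult ν 0)) j))

theorem tendsto_qPoch_mul (q a : ℂ) (n : ℕ) :
    Filter.Tendsto (fun ε : ℂ => qPoch (a * ε) q n) (nhdsWithin 0 {(0 : ℂ)}ᶜ) (nhds 1) := by
  have h : Continuous fun ε : ℂ => qPoch (a * ε) q n := by
    unfold qPoch
    fun_prop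
  have h0 := (h.tendsto 0).mono_left (nhdsWithin_le_nhds (s := {(0 : ℂ)}ᶜ))
  simpa [qPoch] using h0

/-- The Pochhammer quotient in `Phi` without zero parts, as a product of fractions that are
regular at `ε = 0`. -/
theorem qPoch_div_qPoch_inv (q s : ℂ) (hq : q ≠ 0) (hs : s ≠ 0) (n : ℕ) {ε : ℂ} (hε : ε ≠ 0) :
    qPoch ((s * ε)⁻¹ * q ^ ((1 : ℤ) - (n : ℤ))) q n / qPoch (s / ε) q⁻¹ n =
      ∏ i ∈ Finset.range n, (ε - s⁻¹ * q⁻¹ ^ i) / (ε - s * q⁻¹ ^ i) := by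
  unfold qPoch
  rw [← Finset.prod_range_reflect, ← Finset.prod_div_distrib]
  refine Finset.prod_congr rfl fun i hi => ?_
  have hi' : i < n := Finset.mem_range.mp hi
  have hpow : q ^ ((1 : ℤ) - (n : ℤ)) * q ^ (n - 1 - i) = q⁻¹ ^ i := by
    rw [← zpow_natCast q (n - 1 - i), ← zpow_add₀ hq, inv_pow, ← zpow_natCast q i, ← zpow_neg]
    congr 1
    omega
  have hnum : 1 - (s * ε)⁻¹ * q ^ ((1 : ℤ) - (n : ℤ)) * q ^ (n - 1 - i) =
      (ε - s⁻¹ * q⁻¹ ^ i) / ε := by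
    rw [mul_assoc, hpow, mul_inv]
    field_simp
  have hden : 1 - s / ε * q⁻¹ ^ i = (ε - s * q⁻¹ ^ i) / ε := by
    field_simp
  rw [hnum, hden, div_div_div_cancel_right₀ hε]

theorem tendsto_qPoch_div_qPoch_inv (q s : ℂ) (hq : q ≠ 0) (hs : s ≠ 0) (n : ℕ) :
    Filter.Tendsto
      (fun ε : ℂ => qPoch ((s * ε)⁻¹ * q ^ ((1 : ℤ) - (n : ℤ))) q n / qPoch (s / ε) q⁻¹ n)
      (nhdsWithin 0 {(0 : ℂ)}ᶜ) (nhds (s ^ (-(2 * (n : ℤ))))) := by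
  have hlim : Filter.Tendsto
      (fun ε : ℂ => ∏ i ∈ Finset.range n, (ε - s⁻¹ * q⁻¹ ^ i) / (ε - s * q⁻¹ ^ i))
      (nhdsWithin 0 {(0 : ℂ)}ᶜ)
      (nhds (∏ i ∈ Finset.range n, ((0 : ℂ) - s⁻¹ * q⁻¹ ^ i) / (0 - s * q⁻¹ ^ i))) := by
    refine tendsto_finsetProd _ fun i _ => ?_
    have hne : (0 : ℂ) - s * q⁻¹ ^ i ≠ 0 := by simp [hq, hs]
    have hcont : ContinuousAt (fun ε : ℂ => (ε - s⁻¹ * q⁻¹ ^ i) / (ε - s * q⁻¹ ^ i)) 0 :=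
      ContinuousAt.div (by fun_prop) (by fun_prop) hne
    exact hcont.tendsto.mono_left nhdsWithin_le_nhds
  have hval : ∏ i ∈ Finset.range n, ((0 : ℂ) - s⁻¹ * q⁻¹ ^ i) / (0 - s * q⁻¹ ^ i) =
      s ^ (-(2 * (n : ℤ))) := by
    have hfactor : ∀ i ∈ Finset.range n,
        ((0 : ℂ) - s⁻¹ * q⁻¹ ^ i) / (0 - s * q⁻¹ ^ i) = (s ^ 2)⁻¹ := by
      intro i _
      have hqi : q⁻¹ ^ i ≠ 0 := pow_ne_zero _ (inv_ne_zero hq)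
      rw [zero_sub, zero_sub, neg_div_neg_eq, mul_div_mul_right _ _ hqi]
      field_simp
    rw [Finset.prod_congr rfl hfactor, Finset.prod_const, Finset.card_range, zpow_neg, zpow_mul,
      zpow_natCast, inv_pow]
    norm_cast
  rw [← hval]
  refine hlim.congr' ?_
  filter_upwards [self_mem_nhdsWithin] with ε hε
  exact (qPoch_div_qPoch_inv q s hq hs n hε).symm

theorem tendsto_prod_pow_specialization (q s : ℂ) {m : ℕ} (ν : Fin m → ℕ) :
    Filter.Tendsto
      (fun ε : ℂ => ∏ j : Fin m,
        ((q ^ (j : ℕ) * ε - s) / (1 - s * q ^ (j : ℕ) * ε)) ^ ν j)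
      (nhdsWithin 0 {(0 : ℂ)}ᶜ) (nhds ((-s) ^ ∑ j, ν j)) := by
  rw [← Finset.prod_pow_eq_pow_sum]
  refine tendsto_finsetProd _ fun j _ => Filter.Tendsto.pow ?_ _
  have hcont : ContinuousAt
      (fun ε : ℂ => (q ^ (j : ℕ) * ε - s) / (1 - s * q ^ (j : ℕ) * ε)) 0 :=
    ContinuousAt.div (by fun_prop) (by fun_prop) (by simp)
  simpa using hcont.tendsto.mono_left (nhdsWithin_le_nhds (s := {(0 : ℂ)}ᶜ))

theorem sum_castLE_of_eq {m n : ℕ} (h : m ≤ n) (hmn : m = n) (ν : Fin n → ℕ) :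
    ∑ j : Fin m, ν (Fin.castLE h j) = ∑ i, ν i := by
  subst hmn
  rfl

theorem qPoch_one_eq_zero (q : ℂ) {k : ℕ} (hk : k ≠ 0) : qPoch 1 q k = 0 :=
  Finset.prod_eq_zero (Finset.mem_range.mpr (Nat.pos_of_ne_zero hk)) (by simp)

/-- Proposition 6.7: the limit of `Φ_ν(ε)` as `ε → 0` is `(-s)^{|ν|}(s²;q)_n s^{-2n}` if `ν` has
no zero parts (`ν_n > 0`), and `0` otherwise. -/
theorem G_rho_specialization (q s : ℝ) (hq : q ∈ Set.Ioo (0 : ℝ) 1)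
    (hs : s ∈ Set.Ioo (-1 : ℝ) 0) (n : ℕ) (ν : Sign n) :
    Filter.Tendsto (fun ε : ℂ => Phi (q : ℂ) (s : ℂ) ν.1 ε) (nhdsWithin 0 {(0 : ℂ)}ᶜ)
      (nhds (if mult ν.1 0 = 0 then
        (-(s : ℂ)) ^ (∑ i, ν.1 i) * qPoch ((s : ℂ) ^ 2) (q : ℂ) n * (s : ℂ) ^ (-(2 * (n : ℤ)))
        else 0)) := by
  have hq0 : (q : ℂ) ≠ 0 := by exact_mod_cast hq.1.ne'
  have hs0 : (s : ℂ) ≠ 0 := by exact_mod_cast hs.2.ne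
  split_ifs with hk
  · have hprod := tendsto_prod_pow_specialization (q : ℂ) (s : ℂ)
      fun j => ν.1 (Fin.castLE (Nat.sub_le n (mult ν.1 0)) j)
    rw [sum_castLE_of_eq _ (by rw [hk, Nat.sub_zero])] at hprod
    have hlim := (((tendsto_qPoch_div_qPoch_inv (q : ℂ) (s : ℂ) hq0 hs0 n).div
      (tendsto_qPoch_mul (q : ℂ) (s : ℂ) n) one_ne_zero).const_mul
        (qPoch ((s : ℂ) ^ 2) (q : ℂ) n)).mul hprod
    convert hlim using 1
    · funext ε
      have hz : (1 : ℤ) + (mult ν.1 0 : ℤ) - (n : ℤ) = 1 - n := by simp [hk]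
      have hm : n - mult ν.1 0 = n := by rw [hk, Nat.sub_zero]
      have hone : qPoch (1 : ℂ) (q : ℂ) (mult ν.1 0) = 1 := by simp [hk, qPoch]
      have hsq : (s : ℂ) ^ 2 * (q : ℂ) ^ mult ν.1 0 = (s : ℂ) ^ 2 := by simp [hk]
      have hpre : ∀ m : ℕ, m = n → ∀ P : ℂ,
          qPoch ((s : ℂ) ^ 2) (q : ℂ) m * 1 *
              qPoch (((s : ℂ) * ε)⁻¹ * (q : ℂ) ^ ((1 : ℤ) - (n : ℤ))) q m /
            (qPoch ((s : ℂ) / ε) (q : ℂ)⁻¹ m * qPoch ((s : ℂ) * ε) q n) * P =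
          qPoch ((s : ℂ) ^ 2) (q : ℂ) n *
            (qPoch (((s : ℂ) * ε)⁻¹ * (q : ℂ) ^ ((1 : ℤ) - (n : ℤ))) q n /
              qPoch ((s : ℂ) / ε) (q : ℂ)⁻¹ n / qPoch ((s : ℂ) * ε) q n) * P := by
        rintro m rfl P
        rw [mul_one, mul_div_assoc, div_div]
      unfold Phi
      rw [hz, hone, hsq]
      exact hpre _ hm _
    · congr 1
      ring
  · have hzero : (fun ε : ℂ => Phi (q : ℂ) (s : ℂ) ν.1 ε) = fun _ => 0 := by
      funext ε
      simp [Phi, qPoch_one_eq_zero _ hk]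
    rw [hzero]
    exact tendsto_const_nhds

end
end

section
/- Let m ∈ ℤ≥0 and let q, ν, p ∈ ℂ satisfy 1 − qν ≠ 0, (ν;q)_m ≠ 0 and (q;q)_m ≠ 0. Set α = ν(1−q)/(1−qν), β = (q−ν)/(1−qν), γ = (1−q)/(1−qν) (so α+β+γ = 1) and μ = p + ν(1−p). Let R be an associative unital ℂ-algebra and let A, B ∈ R satisfy the quadratic commutation relation B·A = α·A² + β·A·B + γ·B². Then (p·A + (1−p)·B)^m = Σ_{j=0}^m φ_{q,μ,ν}(j|m) · A^j · B^{m−j}, where φ_{q,μ,ν}(j|m) = μ^j·(ν/μ;q)_j·(μ;q)_{m−j}/(ν;q)_m · (q;q)_m/((q;q)_j·(q;q)_{m−j}), with the convention μ^j·(ν/μ;q)_j := ∏_{i=0}^{j−1}(μ − ν q^i) (so the formula is also valid for μ = 0). -/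
open Finset

noncomputable section

/-- The q-deformed Beta-binomial weight `φ_{q,μ,ν}(j|m)`, with the convention
`μ^j·(ν/μ;q)_j := ∏_{i=0}^{j-1}(μ - ν q^i)` (valid also for `μ = 0`). -/
def phiBB (q mu nu : ℂ) (j m : ℕ) : ℂ :=
  (∏ i ∈ Finset.range j, (mu - nu * q ^ i)) * qPoch mu q (m - j) / qPoch nu q m *
    (qPoch q q m / (qPoch q q j * qPoch q q (m - j)))

section qBinomial

variable {K : Type*} [CommRing K]

/-- The Gaussian binomial coefficient `[j + n choose j]_q`, defined by the `q`-Pascal rule. -/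
def gaussBinom (q : K) : ℕ → ℕ → K
  | 0, _ => 1
  | _ + 1, 0 => 1
  | j + 1, n + 1 => q ^ (n + 1) * gaussBinom q j (n + 1) + gaussBinom q (j + 1) n

@[simp] lemma gaussBinom_zero_left (q : K) (n : ℕ) : gaussBinom q 0 n = 1 := by
  simp [gaussBinom]

@[simp] lemma gaussBinom_zero_right (q : K) (j : ℕ) : gaussBinom q j 0 = 1 := by
  cases j <;> simp [gaussBinom]

lemma gaussBinom_succ_succ (q : K) (j n : ℕ) :
    gaussBinom q (j + 1) (n + 1) =
      q ^ (n + 1) * gaussBinom q j (n + 1) + gaussBinom q (j + 1) n := by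
  rw [gaussBinom]

lemma gaussBinom_shift (q : K) (j n : ℕ) :
    (1 - q ^ (j + 1)) * gaussBinom q (j + 1) n =
      (1 - q ^ (n + 1)) * gaussBinom q j (n + 1) := by
  induction j generalizing n with
  | zero =>
    induction n with
    | zero => simp
    | succ n ih =>
      simp only [gaussBinom_succ_succ, gaussBinom_zero_left] at ih ⊢
      linear_combination ih
  | succ j ihj =>
    induction n with
    | zero =>
      have h := ihj 0
      simp only [gaussBinom_succ_succ, gaussBinom_zero_right] at h ⊢
      linear_combination q * h
    | succ n ih =>
      have h := ihj (n + 1)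
      rw [gaussBinom_succ_succ q (j + 1) n, gaussBinom_succ_succ q j (n + 1)]
      rw [gaussBinom_succ_succ q j n] at ih h ⊢
      linear_combination ih + q ^ (n + 2) * h

lemma qPoch_succ (a q : K) (m : ℕ) : qPoch a q (m + 1) = qPoch a q m * (1 - a * q ^ m) :=
  Finset.prod_range_succ _ _

lemma gaussBinom_mul_qPoch (q : K) (j n : ℕ) :
    gaussBinom q j n * (qPoch q q j * qPoch q q n) = qPoch q q (j + n) := by
  induction j generalizing n with
  | zero => simp [qPoch]
  | succ j ih =>
    have h := ih (n + 1)
    rw [show j + 1 + n = j + (n + 1) by ring, ← h, qPoch_succ q q j, qPoch_succ q q n]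
    linear_combination qPoch q q j * qPoch q q n * gaussBinom_shift q j n

/-- The numerator of the `q`-deformed Beta-binomial weight. -/
def betaWeight (q mu nu : K) (j n : ℕ) : K :=
  (∏ i ∈ Finset.range j, (mu - nu * q ^ i)) * qPoch mu q n * gaussBinom q j n

lemma betaWeight_succ_zero (q mu nu : K) (j : ℕ) :
    betaWeight q mu nu (j + 1) 0 = (mu - nu * q ^ j) * betaWeight q mu nu j 0 := by
  simp only [betaWeight, Finset.prod_range_succ, gaussBinom_zero_right]
  ring

lemma betaWeight_zero_succ (q mu nu : K) (n : ℕ) :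
    betaWeight q mu nu 0 (n + 1) = (1 - mu * q ^ n) * betaWeight q mu nu 0 n := by
  simp only [betaWeight, qPoch_succ, gaussBinom_zero_left]
  ring

lemma betaWeight_succ_succ (q mu nu : K) (j n : ℕ) :
    betaWeight q mu nu (j + 1) (n + 1) =
      q ^ (n + 1) * (mu - nu * q ^ j) * betaWeight q mu nu j (n + 1) +
        (1 - mu * q ^ n) * betaWeight q mu nu (j + 1) n := by
  simp only [betaWeight, Finset.prod_range_succ, qPoch_succ, gaussBinom_succ_succ]
  ring

lemma betaWeight_shift (q mu nu : K) (j n : ℕ) :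
    (1 - q ^ (n + 1)) * (mu - nu * q ^ j) * betaWeight q mu nu j (n + 1) =
      (1 - q ^ (j + 1)) * (1 - mu * q ^ n) * betaWeight q mu nu (j + 1) n := by
  simp only [betaWeight, Finset.prod_range_succ, qPoch_succ]
  linear_combination (-(∏ i ∈ Finset.range j, (mu - nu * q ^ i)) * (mu - nu * q ^ j) *
    qPoch mu q n * (1 - mu * q ^ n)) * gaussBinom_shift q j n

lemma phiBB_eq_betaWeight_div {q mu nu : ℂ} {j n : ℕ} (h : qPoch q q (j + n) ≠ 0) :
    phiBB q mu nu j (j + n) = betaWeight q mu nu j n / qPoch nu q (j + n) := by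
  rw [← gaussBinom_mul_qPoch] at h
  rw [phiBB, betaWeight, Nat.add_sub_cancel_left, ← gaussBinom_mul_qPoch q j n,
    mul_div_cancel_right₀ _ (right_ne_zero_of_mul h)]
  ring

end qBinomial

/-- Summation over the antidiagonal of a function satisfying a Pascal-type recursion. -/
lemma sum_antidiagonal_succ_of_pascal {M : Type*} [AddCommMonoid M] (f u v : ℕ → ℕ → M)
    (h₁ : ∀ j, f (j + 1) 0 = u j 0) (h₂ : ∀ n, f 0 (n + 1) = v 0 n)
    (h₃ : ∀ j n, f (j + 1) (n + 1) = u j (n + 1) + v (j + 1) n) (m : ℕ) :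
    ∑ x ∈ antidiagonal (m + 1), f x.1 x.2 = ∑ x ∈ antidiagonal m, (u x.1 x.2 + v x.1 x.2) := by
  rw [Finset.sum_add_distrib]
  cases m with
  | zero => simp [Finset.Nat.antidiagonal_succ, h₁, h₂, add_comm]
  | succ m =>
    rw [Finset.Nat.sum_antidiagonal_succ, Finset.Nat.sum_antidiagonal_succ',
      Finset.Nat.sum_antidiagonal_succ' (f := fun x => u x.1 x.2),
      Finset.Nat.sum_antidiagonal_succ (f := fun x => v x.1 x.2)]
    simp only [h₁, h₂, h₃, Finset.sum_add_distrib]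
    abel

section qPlane

variable {K R : Type*} [CommRing K] [Ring R] [Algebra K R] {q nu : K} {B C : R}

lemma pow_succ_mul_of_qCommute
    (hBC : B * C = q • (C * B) + (nu * (1 - q)) • (C * C)) (n : ℕ) :
    B ^ (n + 1) * C =
      q ^ (n + 1) • (C * B ^ (n + 1)) + (nu * (1 - q ^ (n + 1))) • (C * B ^ n * C) := by
  induction n with
  | zero => simpa using hBC
  | succ n ih =>
    have h : B ^ (n + 1 + 1) * C =
        q ^ (n + 1) • ((B * C) * B ^ (n + 1)) +
          (nu * (1 - q ^ (n + 1))) • ((B * C) * B ^ n * C) := by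
      rw [pow_succ' B (n + 1), mul_assoc, ih, mul_add, mul_smul_comm, mul_smul_comm]
      simp only [mul_assoc]
    have h_aux : C * (B ^ (n + 1) * C) = q ^ (n + 1) • (C * C * B ^ (n + 1)) +
        (nu * (1 - q ^ (n + 1))) • (C * C * B ^ n * C) := by
      rw [ih, mul_add, mul_smul_comm, mul_smul_comm]
      simp only [mul_assoc]
    have e₁ : C * B * B ^ (n + 1) = C * B ^ (n + 1 + 1) := by rw [mul_assoc, ← pow_succ']
    have e₂ : C * B * B ^ n * C = C * (B ^ (n + 1) * C) := by
      rw [mul_assoc C, ← pow_succ', mul_assoc]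
    rw [h, hBC]
    simp only [add_mul, smul_mul_assoc, e₁, e₂]
    rw [mul_assoc C (B ^ (n + 1)) C]
    linear_combination (norm := module) (-(nu * (1 - q))) • h_aux

/-- The one-step identity behind the expansion: the sum of the two Pascal contributions of
`A ^ j * B ^ n`, where `A = B + (1 - nu) • C`. -/
lemma pascal_step_of_qCommute
    (hBC : B * C = q • (C * B) + (nu * (1 - q)) • (C * C)) (mu : K) (j n : ℕ) :
    (q ^ n * (mu - nu * q ^ j)) • ((B + (1 - nu) • C) * B ^ n) +
        (nu * (1 - q ^ n) * (mu - nu * q ^ j)) • ((B + (1 - nu) • C) * B ^ (n - 1) * C) +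
        ((1 - mu * q ^ n) • B ^ (n + 1) -
          (nu * (1 - q ^ j) * (1 - mu * q ^ n)) • (B ^ n * C)) =
      (1 - nu * q ^ (j + n)) • (B ^ n * (B + (mu - nu) • C)) := by
  cases n with
  | zero =>
    simp only [pow_zero, mul_one, one_mul, zero_add, pow_one, add_zero, sub_self, mul_zero,
      zero_mul, zero_smul]
    module
  | succ n =>
    have h := pow_succ_mul_of_qCommute hBC n
    simp only [Nat.add_sub_cancel, add_mul, mul_add, smul_mul_assoc, mul_smul_comm, ← pow_succ',
      ← pow_succ]
    linear_combination (norm := module) (-((1 - nu) * (mu - nu * q ^ j))) • h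

theorem sum_betaWeight_of_qCommute
    (hBC : B * C = q • (C * B) + (nu * (1 - q)) • (C * C)) (mu : K) (m : ℕ) :
    ∑ x ∈ antidiagonal m,
        betaWeight q mu nu x.1 x.2 • ((B + (1 - nu) • C) ^ x.1 * B ^ x.2) =
      qPoch nu q m • (B + (mu - nu) • C) ^ m := by
  induction m with
  | zero => simp [betaWeight, qPoch]
  | succ m ih =>
    have hstep := pascal_step_of_qCommute hBC mu
    set A := B + (1 - nu) • C
    rw [sum_antidiagonal_succ_of_pascal
      (fun j n => betaWeight q mu nu j n • (A ^ j * B ^ n))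
      (fun j n => betaWeight q mu nu j n • ((q ^ n * (mu - nu * q ^ j)) • (A ^ (j + 1) * B ^ n) +
        (nu * (1 - q ^ n) * (mu - nu * q ^ j)) • (A ^ (j + 1) * B ^ (n - 1) * C)))
      (fun j n => betaWeight q mu nu j n • ((1 - mu * q ^ n) • (A ^ j * B ^ (n + 1)) -
        (nu * (1 - q ^ j) * (1 - mu * q ^ n)) • (A ^ j * B ^ n * C)))]
    · rw [qPoch_succ, pow_succ, mul_comm (qPoch nu q m), mul_smul, ← smul_mul_assoc, ← ih,
        Finset.sum_mul, Finset.smul_sum]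
      refine Finset.sum_congr rfl fun x hx => ?_
      obtain ⟨j, n⟩ := x
      obtain rfl : j + n = m := by simpa using hx
      have h := congrArg (fun y => A ^ j * y) (hstep j n)
      simp only [mul_add (A ^ j), mul_sub (A ^ j), mul_smul_comm, ← mul_assoc,
        ← pow_succ A] at h
      rw [← smul_add, smul_mul_assoc, smul_comm (1 - nu * q ^ (j + n)), ← h]
    · intro j
      simp only [betaWeight_succ_zero, pow_zero, sub_self, mul_zero, zero_mul, zero_smul, add_zero]
      module
    · intro n
      simp only [betaWeight_zero_succ, pow_zero, sub_self, mul_zero, zero_mul, zero_smul, sub_zero]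
      module
    · intro j n
      rw [betaWeight_succ_succ, Nat.add_sub_cancel]
      have h := congrArg (fun c => (nu * c) • (A ^ (j + 1) * B ^ n * C))
        (betaWeight_shift q mu nu j n)
      linear_combination (norm := module) -h

end qPlane

/-- The quadratic relation becomes a `q`-commutation relation for `B` and `A - B`, rescaled. -/
lemma qCommute_of_quadratic {K R : Type*} [Field K] [Ring R] [Algebra K R] {q nu : K} {A B : R}
    (h1 : 1 - q * nu ≠ 0) (hnu : 1 - nu ≠ 0)
    (hAB : B * A = (nu * (1 - q) / (1 - q * nu)) • (A ^ 2) +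
      ((q - nu) / (1 - q * nu)) • (A * B) + ((1 - q) / (1 - q * nu)) • (B ^ 2)) :
    B * ((1 - nu)⁻¹ • (A - B)) = q • ((1 - nu)⁻¹ • (A - B) * B) +
      (nu * (1 - q)) • ((1 - nu)⁻¹ • (A - B) * (1 - nu)⁻¹ • (A - B)) := by
  have h : (1 - q * nu) • (B * A) =
      (nu * (1 - q)) • (A ^ 2) + (q - nu) • (A * B) + (1 - q) • (B ^ 2) := by
    rw [hAB]
    simp only [smul_add, smul_smul, mul_div_cancel₀ _ h1]
  have h_aux : (1 - nu) • (B * (A - B)) = (q * (1 - nu)) • ((A - B) * B) +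
      (nu * (1 - q)) • ((A - B) * (A - B)) := by
    simp only [mul_sub, sub_mul, pow_two] at h ⊢
    linear_combination (norm := module) h
  have h_scaled := congrArg (fun y => ((1 - nu)⁻¹ * (1 - nu)⁻¹) • y) h_aux
  simp only [smul_add, smul_smul] at h_scaled
  simp only [mul_smul_comm, smul_mul_assoc, smul_smul]
  convert h_scaled using 3 <;> field_simp

/-- Povolotsky's theorem: expansion of `(pA + (1-p)B)^m` in the quadratic algebra. -/
theorem povolotsky (m : ℕ) (q nu p : ℂ) (h1 : 1 - q * nu ≠ 0)
    (h2 : qPoch nu q m ≠ 0) (h3 : qPoch q q m ≠ 0)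
    (R : Type*) [Ring R] [Algebra ℂ R] (A B : R)
    (hAB : B * A = (nu * (1 - q) / (1 - q * nu)) • (A ^ 2) +
      ((q - nu) / (1 - q * nu)) • (A * B) + ((1 - q) / (1 - q * nu)) • (B ^ 2)) :
    (p • A + (1 - p) • B) ^ m
      = ∑ j ∈ Finset.range (m + 1), phiBB q (p + nu * (1 - p)) nu j m • (A ^ j * B ^ (m - j)) := by
  rcases Nat.eq_zero_or_pos m with rfl | hm
  · simp [phiBB, qPoch]
  have hnu : 1 - nu ≠ 0 := by
    simpa using Finset.prod_ne_zero_iff.mp h2 0 (Finset.mem_range.mpr hm)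
  have key := sum_betaWeight_of_qCommute (qCommute_of_quadratic h1 hnu hAB) (p + nu * (1 - p)) m
  have hA : B + (1 - nu) • (1 - nu)⁻¹ • (A - B) = A := by
    rw [smul_inv_smul₀ hnu, add_sub_cancel]
  have hX : B + (p + nu * (1 - p) - nu) • (1 - nu)⁻¹ • (A - B) = p • A + (1 - p) • B := by
    rw [show p + nu * (1 - p) - nu = p * (1 - nu) by ring, mul_smul, smul_inv_smul₀ hnu]
    module
  rw [hA, hX] at key
  rw [← Finset.Nat.sum_antidiagonal_eq_sum_range_succ
    (fun j n => phiBB q (p + nu * (1 - p)) nu j m • (A ^ j * B ^ n)),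
    ← inv_smul_smul₀ h2 ((p • A + (1 - p) • B) ^ m), ← key, Finset.smul_sum]
  refine Finset.sum_congr rfl fun x hx => ?_
  obtain rfl : x.1 + x.2 = m := by simpa using hx
  rw [phiBB_eq_betaWeight_div h3, smul_smul, div_eq_inv_mul]

end
end

section
/- Let q ∈ (0,1), s ∈ (−1,0), k ∈ ℤ≥1, and let r₁ > r₂ > … > r_k be radii with |s| < r_k and r₁ < |s|^{−1}. Then for any λ, μ ∈ Sign⁺_k the spatial orthogonality relation holds: (2πi)^{−k} ∮_{|u₁|=r₁} ⋯ ∮_{|u_k|=r_k} ∏_{1≤α<β≤k} (u_α−u_β)/(u_α−qu_β) · F^c_λ(u₁,…,u_k) · ∏_{i=1}^k [ 1/(u_i−s) · ((1−su_i)/(u_i−s))^{μ_i} ] du₁⋯du_k = 1 if λ = μ and = 0 otherwise, where each circle is positively oriented and centered at the origin. -/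
open Finset

noncomputable section

/-- Iterated integral: `iterInt k ops f` applies the integration functional `ops i` to the
`i`-th variable (outermost first). -/
def iterInt : (k : ℕ) → (Fin k → ((ℂ → ℂ) → ℂ)) → ((Fin k → ℂ) → ℂ) → ℂ
  | 0, _, f => f Fin.elim0
  | k + 1, ops, f => ops 0 (fun z => iterInt k (fun i => ops i.succ) (fun u => f (Fin.cons z u)))

/-- The product of `H i j` over all pairs `i < j`. -/
def prodLT {M : Type*} [CommMonoid M] {n : ℕ} (H : Fin n → Fin n → M) : M :=
  ∏ p ∈ (Finset.univ : Finset (Fin n × Fin n)).filter (fun p => p.1 < p.2), H p.1 p.2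

/-- The number of later indices at which `f` takes the same value as at `j`. -/
def laterCount {n : ℕ} (f : Fin n → ℕ) (j : Fin n) : ℕ :=
  (univ.filter (fun l => j < l ∧ f l = f j)).card

section PairProducts

variable {M : Type*} [CommMonoid M]

theorem prodLT_eq_prod_ite {n : ℕ} (H : Fin n → Fin n → M) :
    prodLT H = ∏ i, ∏ j, if i < j then H i j else 1 := by
  rw [prodLT, prod_filter, Fintype.prod_prod_type]

theorem prodLT_succ {n : ℕ} (H : Fin (n + 1) → Fin (n + 1) → M) :
    prodLT H = (∏ j : Fin n, H 0 j.succ) * prodLT (fun i j : Fin n => H i.succ j.succ) := by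
  simp [prodLT_eq_prod_ite, Fin.prod_univ_succ]

theorem prodLT_mul {n : ℕ} (H K : Fin n → Fin n → M) :
    prodLT (fun i j => H i j * K i j) = prodLT H * prodLT K :=
  prod_mul_distrib

theorem prodLT_congr {n : ℕ} {H K : Fin n → Fin n → M} (h : ∀ i j, i < j → H i j = K i j) :
    prodLT H = prodLT K :=
  prod_congr rfl fun p hp => h _ _ (by simpa using hp)

/-- A product over pairs selected by a strict order `f` on the indices, as a product over
pairs `i < j`. -/
theorem prod_ite_lt_eq_prodLT {n : ℕ} {α : Type*} [LinearOrder α] (f : Fin n → α)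
    (G : Fin n → Fin n → M) :
    (∏ i, ∏ j, if f i < f j then G i j else 1) =
      prodLT (fun i j => (if f i < f j then G i j else 1) * if f j < f i then G j i else 1) := by
  rw [prodLT_mul, prodLT_eq_prod_ite, prodLT_eq_prod_ite,
    prod_comm (f := fun i j => if i < j then if f j < f i then G j i else 1 else 1)]
  simp_rw [← prod_mul_distrib]
  refine prod_congr rfl fun i _ => prod_congr rfl fun j _ => ?_
  rcases lt_trichotomy i j with h | rfl | h
  · simp [h, h.not_gt]
  · simp
  · simp [h, h.not_gt]

theorem prodLT_perm {n : ℕ} (σ : Equiv.Perm (Fin n)) (G : Fin n → Fin n → M) :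
    prodLT (fun i j => G (σ i) (σ j)) =
      prodLT (fun i j => if σ.symm i < σ.symm j then G i j else G j i) := by
  have h : prodLT (fun i j => G (σ i) (σ j)) =
      ∏ i, ∏ j, if σ.symm i < σ.symm j then G i j else 1 := by
    rw [prodLT_eq_prod_ite,
      ← Equiv.prod_comp σ (fun i => ∏ j, if σ.symm i < σ.symm j then G i j else 1)]
    refine prod_congr rfl fun i _ => ?_
    rw [← Equiv.prod_comp σ (fun j => if σ.symm (σ i) < σ.symm j then G (σ i) j else 1)]
    simp
  rw [h, prod_ite_lt_eq_prodLT]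
  refine prodLT_congr fun i j hij => ?_
  have hne : σ.symm i ≠ σ.symm j := fun e => hij.ne (σ.symm.injective e)
  rcases lt_or_gt_of_ne hne with h | h
  · simp [h, h.not_gt]
  · simp [h, h.not_gt]

theorem mult_succ {n : ℕ} (f : Fin (n + 1) → ℕ) (v : ℕ) :
    mult f v = mult (fun j : Fin n => f j.succ) v + if f 0 = v then 1 else 0 := by
  simp only [mult, card_filter, Fin.sum_univ_succ]
  exact add_comm _ _

theorem laterCount_succ {n : ℕ} (f : Fin (n + 1) → ℕ) (j : Fin n) :
    laterCount f j.succ = laterCount (fun j : Fin n => f j.succ) j := by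
  simp [laterCount, card_filter, Fin.sum_univ_succ, -sum_boole]

theorem laterCount_zero {n : ℕ} (f : Fin (n + 1) → ℕ) :
    laterCount f 0 = mult (fun j : Fin n => f j.succ) (f 0) := by
  simp [laterCount, mult, card_filter, Fin.sum_univ_succ, -sum_boole]

theorem prod_laterCount_fiber {n : ℕ} (f : Fin n → ℕ) (v : ℕ) (F : ℕ → M) :
    (∏ j, if f j = v then F (laterCount f j) else 1) = ∏ i ∈ range (mult f v), F i := by
  induction n with
  | zero => simp [mult]
  | succ n ih =>
    rw [Fin.prod_univ_succ, mult_succ]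
    simp only [laterCount_succ, ih (fun j : Fin n => f j.succ), laterCount_zero]
    split_ifs with h
    · rw [prod_range_succ, h, mul_comm]
    · simp

theorem prod_laterCount {n : ℕ} (f : Fin n → ℕ) (F : ℕ → M) :
    ∏ j, F (laterCount f j) = ∏ᶠ v : ℕ, ∏ i ∈ range (mult f v), F i := by
  have hsub : (Function.mulSupport fun v : ℕ => ∏ i ∈ range (mult f v), F i) ⊆
      (univ.image f : Finset ℕ) := by
    intro v hv
    by_contra hcon
    refine hv ?_
    have : mult f v = 0 := by
      rw [mult, card_eq_zero, filter_eq_empty_iff]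
      rintro j - rfl
      exact hcon (by simp)
    simp [this]
  rw [finprod_eq_prod_of_mulSupport_subset _ hsub]
  simp_rw [← prod_laterCount_fiber f]
  rw [prod_comm]
  refine prod_congr rfl fun j _ => ?_
  rw [prod_ite_eq]
  simp

end PairProducts

theorem cconst_eq_prod (q s : ℂ) {n : ℕ} (f : Fin n → ℕ) :
    cconst q s f =
      ∏ j, (1 - s ^ 2 * q ^ laterCount f j) / (1 - q ^ (laterCount f j + 1)) := by
  rw [cconst, prod_laterCount f (fun e => (1 - s ^ 2 * q ^ e) / (1 - q ^ (e + 1)))]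
  refine finprod_congr fun v => ?_
  rw [qPoch, qPoch, prod_div_distrib]
  simp only [pow_succ']

section Symmetrization

variable {K : Type*} [Field K]

/-- The sum over the nodes of `∏ (u i - q u j) / (u i - u j)` is the `q`-integer `[#S]_q`. -/
theorem sum_prod_erase_div {ι : Type*} [DecidableEq ι] (q : K) (hq : q ≠ 1) (S : Finset ι)
    (u : ι → K) (hu : Set.InjOn u S) (hu0 : ∀ i ∈ S, u i ≠ 0) :
    ∑ i ∈ S, ∏ j ∈ S.erase i, (u i - q * u j) / (u i - u j) = (1 - q ^ S.card) / (1 - q) := by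
  open Polynomial in
  rcases S.eq_empty_or_nonempty with rfl | hS
  · simp
  have h1q : 1 - q ≠ 0 := sub_ne_zero.2 hq.symm
  set P : K[X] := ∏ j ∈ S, (X - C (q * u j)) with hP
  set Q : K[X] := ∏ j ∈ S, (X - C (u j)) with hQ
  have hPm : P.Monic := monic_prod_of_monic _ _ fun j _ => monic_X_sub_C _
  have hQm : Q.Monic := monic_prod_of_monic _ _ fun j _ => monic_X_sub_C _
  have hPd : P.natDegree = S.card := by
    rw [hP, natDegree_prod_of_monic _ _ fun j _ => monic_X_sub_C _]
    simp only [natDegree_X_sub_C, sum_const, smul_eq_mul, mul_one]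
  have hQd : Q.natDegree = S.card := by
    rw [hQ, natDegree_prod_of_monic _ _ fun j _ => monic_X_sub_C _]
    simp only [natDegree_X_sub_C, sum_const, smul_eq_mul, mul_one]
  set D : K[X] := P - C (q ^ S.card) * Q with hD
  have hD0 : D.coeff 0 = 0 := by
    rw [coeff_zero_eq_eval_zero]
    simp only [hD, hP, hQ, eval_sub, eval_mul, eval_C, eval_prod, eval_X]
    rw [← prod_const, ← prod_mul_distrib, sub_eq_zero]
    exact prod_congr rfl fun j _ => by ring
  have hDX : D.divX * X = D := by
    have := divX_mul_X_add D
    rwa [hD0, C_0, add_zero] at this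
  have hDn : D.natDegree ≤ S.card := by
    refine (natDegree_sub_le _ _).trans (max_le hPd.le ?_)
    exact (natDegree_C_mul_le _ _).trans hQd.le
  have hcard : S.card ≠ 0 := hS.card_pos.ne'
  have hdeg : D.divX.degree < S.card := by
    refine lt_of_le_of_lt degree_le_natDegree ?_
    rw [natDegree_divX_eq_natDegree_tsub_one]
    exact_mod_cast (by omega : D.natDegree - 1 < S.card)
  have hcoeff := Lagrange.coeff_eq_sum hu hdeg
  rw [coeff_divX, Nat.sub_add_cancel (Nat.one_le_iff_ne_zero.2 hcard)] at hcoeff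
  have hlead : D.coeff S.card = 1 - q ^ S.card := by
    have hPc : P.coeff S.card = 1 := hPd ▸ hPm.coeff_natDegree
    have hQc : Q.coeff S.card = 1 := hQd ▸ hQm.coeff_natDegree
    rw [hD, coeff_sub, coeff_C_mul, hPc, hQc, mul_one]
  rw [eq_div_iff h1q, ← hlead, hcoeff, sum_mul]
  refine sum_congr rfl fun i hi => ?_
  have hev : D.divX.eval (u i) = (1 - q) * ∏ j ∈ S.erase i, (u i - q * u j) := by
    have h1 : D.divX.eval (u i) * u i = D.eval (u i) := by
      conv_rhs => rw [← hDX]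
      simp
    have h2 : D.eval (u i) = (u i - q * u i) * ∏ j ∈ S.erase i, (u i - q * u j) := by
      rw [mul_prod_erase S (fun j => u i - q * u j) hi]
      simp only [hD, hP, hQ, eval_sub, eval_mul, eval_C, eval_prod, eval_X]
      rw [prod_eq_zero (f := fun j => u i - u j) hi (sub_self _), mul_zero, sub_zero]
    refine mul_right_cancel₀ (hu0 i hi) ?_
    rw [h1, h2]
    ring
  rw [hev, prod_div_distrib]
  ring

/-- Summing the Hall-Littlewood kernel over the permutations that preserve an antitone `f`
leaves the pairs on which `f` differs and a product of `q`-factorials. -/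
theorem sum_stabilizer_prodLT (q : K) (hq : q ≠ 1) {n : ℕ} (f : Fin n → ℕ) (hf : Antitone f)
    (u : Fin n → K) (hu : Function.Injective u) (hu0 : ∀ i, u i ≠ 0) :
    (∑ σ : Equiv.Perm (Fin n), if f ∘ σ = f then
        prodLT (fun i j => (u (σ i) - q * u (σ j)) / (u (σ i) - u (σ j))) else 0) =
      (∏ i, ∏ j, if f j < f i then (u i - q * u j) / (u i - u j) else 1) *
        ∏ j, (1 - q ^ (laterCount f j + 1)) / (1 - q) := by
  induction n with
  | zero => simp [prodLT, Subsingleton.elim _ f]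
  | succ n ih =>
    set G : Fin (n + 1) → Fin (n + 1) → K := fun i j => (u i - q * u j) / (u i - u j) with hG
    set f' : Fin n → ℕ := fun j => f j.succ with hf'
    have hf'a : Antitone f' := fun i j h => hf (Fin.succ_le_succ_iff.2 h)
    have hle (j : Fin (n + 1)) : f j ≤ f 0 := hf (Fin.zero_le j)
    rw [← Equiv.sum_comp Equiv.Perm.decomposeFin.symm, Fintype.sum_prod_type]
    have key (p : Fin (n + 1)) (hp : f p = f 0) (i : Fin (n + 1)) :
        f (Equiv.swap 0 p i) = f i := by
      by_cases h0 : i = 0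
      · simp [h0, hp]
      · by_cases h1 : i = p
        · simp [h1, hp]
        · rw [Equiv.swap_apply_of_ne_of_ne h0 h1]
    have hterm (p : Fin (n + 1)) :
        (∑ e : Equiv.Perm (Fin n), if f ∘ Equiv.Perm.decomposeFin.symm (p, e) = f then
          prodLT (fun i j => G (Equiv.Perm.decomposeFin.symm (p, e) i)
            (Equiv.Perm.decomposeFin.symm (p, e) j)) else 0) =
        if f p = f 0 then
          (∏ j ∈ (univ.filter fun i => f i = f 0).erase p, G p j) *
          ((∏ i, ∏ j, if f j < f i then G i j else 1) *
            ∏ j, (1 - q ^ (laterCount f' j + 1)) / (1 - q)) else 0 := by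
      split_ifs with hp
      swap
      · refine sum_eq_zero fun e _ => if_neg fun h => hp ?_
        simpa using congrFun h 0
      have hcond (e : Equiv.Perm (Fin n)) :
          f ∘ Equiv.Perm.decomposeFin.symm (p, e) = f ↔ f' ∘ e = f' := by
        simp only [funext_iff, Fin.forall_fin_succ, Function.comp_apply,
          Equiv.Perm.decomposeFin_symm_apply_zero, Equiv.Perm.decomposeFin_symm_apply_succ,
          key p hp, hp, true_and, hf']
      have hsplit (e : Equiv.Perm (Fin n)) :
          prodLT (fun i j => G (Equiv.Perm.decomposeFin.symm (p, e) i)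
            (Equiv.Perm.decomposeFin.symm (p, e) j)) =
          (∏ j : Fin n, G p (Equiv.swap 0 p j.succ)) *
            prodLT (fun i j => G (Equiv.swap 0 p (e i).succ) (Equiv.swap 0 p (e j).succ)) := by
        rw [prodLT_succ]
        simp only [Equiv.Perm.decomposeFin_symm_apply_zero,
          Equiv.Perm.decomposeFin_symm_apply_succ]
        rw [Equiv.prod_comp e (fun j : Fin n => G p (Equiv.swap 0 p j.succ))]
      simp only [hcond, hsplit]
      have hIH := ih f' hf'a (fun j => u (Equiv.swap 0 p j.succ))
        (fun a b h => Fin.succ_injective _ ((Equiv.swap 0 p).injective (hu h)))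
        (fun i => hu0 _)
      have hpull : (∑ e : Equiv.Perm (Fin n), if f' ∘ e = f' then
          (∏ j : Fin n, G p (Equiv.swap 0 p j.succ)) *
            prodLT (fun i j => G (Equiv.swap 0 p (e i).succ) (Equiv.swap 0 p (e j).succ))
              else 0) =
          (∏ j : Fin n, G p (Equiv.swap 0 p j.succ)) *
          ∑ e : Equiv.Perm (Fin n), if f' ∘ e = f' then
            prodLT (fun i j => G (Equiv.swap 0 p (e i).succ) (Equiv.swap 0 p (e j).succ))
              else 0 := by
        rw [mul_sum]
        exact sum_congr rfl fun e _ => by split_ifs <;> simp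
      rw [hpull, hG, hIH, ← mul_assoc, ← mul_assoc]
      congr 1
      have hcross : (∏ i, ∏ j, if f j < f i then G i j else 1) =
          (∏ j : Fin n, if f j.succ < f 0 then G p (Equiv.swap 0 p j.succ) else 1) *
          ∏ i : Fin n, ∏ j : Fin n, if f' j < f' i then
            G (Equiv.swap 0 p i.succ) (Equiv.swap 0 p j.succ) else 1 := by
        rw [← Equiv.prod_comp (Equiv.swap 0 p)
          (fun i => ∏ j, if f j < f i then G i j else 1)]
        have (i : Fin (n + 1)) : (∏ j, if f j < f (Equiv.swap 0 p i) then
            G (Equiv.swap 0 p i) j else 1) =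
            ∏ j, if f j < f i then G (Equiv.swap 0 p i) (Equiv.swap 0 p j) else 1 := by
          rw [← Equiv.prod_comp (Equiv.swap 0 p)
            (fun j => if f j < f (Equiv.swap 0 p i) then G (Equiv.swap 0 p i) j else 1)]
          simp only [key p hp]
        simp only [this]
        rw [Fin.prod_univ_succ]
        congr 1
        · rw [Fin.prod_univ_succ]; simp
        · refine prod_congr rfl fun i _ => ?_
          rw [Fin.prod_univ_succ]
          simp [(hle _).not_gt, hf']
      have hsame : (∏ j ∈ (univ.filter fun i => f i = f 0).erase p, G p j) =
          ∏ j : Fin n, if f j.succ = f 0 then G p (Equiv.swap 0 p j.succ) else 1 := by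
        have h1 : (∏ j ∈ (univ.filter fun i => f i = f 0).erase p, G p j) =
            ∏ j, if f j = f 0 ∧ j ≠ p then G p j else 1 := by
          rw [← prod_filter]
          congr 1
          ext j
          simp [and_comm]
        rw [h1, ← Equiv.prod_comp (Equiv.swap 0 p), Fin.prod_univ_succ]
        simp only [key p hp, Equiv.swap_apply_left, ne_eq, not_true_eq_false, and_false,
          if_false, one_mul]
        refine prod_congr rfl fun j _ => ?_
        have : Equiv.swap 0 p j.succ ≠ p := by
          rw [Ne, Equiv.swap_apply_eq_iff, Equiv.swap_apply_right]
          exact Fin.succ_ne_zero j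
        simp [this]
      rw [hcross, hsame, ← mul_assoc]
      congr 1
      rw [← prod_mul_distrib]
      refine prod_congr rfl fun j _ => ?_
      rcases (hle j.succ).lt_or_eq with h | h
      · simp [h, h.ne, hG]
      · simp [h, hG]
    rw [sum_congr rfl fun p _ => hterm p, ← sum_filter, ← sum_mul, hG,
      sum_prod_erase_div q hq _ u hu.injOn (fun i _ => hu0 i), Fin.prod_univ_succ (n := n)
        (f := fun j => (1 - q ^ (laterCount f j + 1)) / (1 - q))]
    have hc : (univ.filter fun i => f i = f 0).card = laterCount f 0 + 1 := by
      change mult f (f 0) = _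
      rw [laterCount_zero, mult_succ, if_pos rfl]
    simp only [hc, laterCount_succ]
    ring

end Symmetrization

section ContourIntegrals

open MeasureTheory Filter Topology

/-- A function that is holomorphic on and outside a circle and is `o(1 / z)` at infinity has
vanishing integral over the circle. -/
theorem circleIntegral_eq_zero_of_tendsto_cobounded {f : ℂ → ℂ} {r : ℝ} (hr : 0 < r)
    (hd : ∀ z, r ≤ ‖z‖ → DifferentiableAt ℂ f z)
    (hlim : Tendsto (fun z => z * f z) (Bornology.cobounded ℂ) (𝓝 0)) :
    (∮ z in C(0, r), f z) = 0 := by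
  rw [← norm_le_zero_iff]
  refine le_of_forall_pos_le_add fun ε hε => ?_
  have h1 : ∀ᶠ z in Bornology.cobounded ℂ, ‖z * f z‖ < ε / (2 * Real.pi) := by
    have := hlim.norm
    rw [norm_zero] at this
    exact this.eventually_lt_const (by positivity)
  obtain ⟨R₀, -, hR₀⟩ := (hasBasis_cobounded_norm (E := ℂ)).eventually_iff.1 h1
  set R := max r R₀
  have hR0 : 0 < R := lt_max_of_lt_left hr
  have heq : (∮ z in C(0, R), f z) = ∮ z in C(0, r), f z := by
    refine Complex.circleIntegral_eq_of_differentiable_on_annulus_off_countable hr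
      (le_max_left _ _) Set.countable_empty (fun z hz => ?_) fun z hz => ?_
    · refine (hd z ?_).continuousAt.continuousWithinAt
      simpa using hz.2
    · refine hd z ?_
      have := hz.1.2
      simp only [Metric.mem_closedBall, dist_zero_right, not_le] at this
      exact this.le
  rw [← heq, zero_add]
  refine (circleIntegral.norm_integral_le_of_norm_le_const hR0.le
    (C := ε / (2 * Real.pi) / R) fun z hz => ?_).trans_eq ?_
  · have hzR : ‖z‖ = R := by simpa using hz
    have := hR₀ (show z ∈ {x : ℂ | R₀ ≤ ‖x‖} by
      simp only [Set.mem_ofPred_eq, hzR]; exact le_max_right _ _)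
    rw [norm_mul, hzR] at this
    rw [le_div_iff₀ hR0, mul_comm]
    exact this.le
  · field_simp

theorem circleIntegral_eq_zero_of_differentiableAt {f : ℂ → ℂ} {r : ℝ} (hr : 0 ≤ r)
    (hd : ∀ z, ‖z‖ ≤ r → DifferentiableAt ℂ f z) : (∮ z in C(0, r), f z) = 0 :=
  Complex.circleIntegral_eq_zero_of_differentiable_on_off_countable hr Set.countable_empty
    (fun z hz => (hd z (by simpa using hz)).continuousAt.continuousWithinAt)
    fun z hz => hd z (by simpa using (Metric.ball_subset_closedBall hz.1))

theorem norm_torusMap_zero {n : ℕ} {r : Fin n → ℝ} (hr : ∀ i, 0 < r i) (θ : Fin n → ℝ)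
    (i : Fin n) : ‖torusMap 0 r θ i‖ = r i := by
  simp [torusMap, abs_of_pos (hr i)]

theorem continuous_torusMap {n : ℕ} (c : Fin n → ℂ) (r : Fin n → ℝ) :
    Continuous (torusMap c r) := by
  unfold torusMap
  fun_prop

theorem torusIntegrable_of_continuous {n : ℕ} {f : (Fin n → ℂ) → ℂ} {r : Fin n → ℝ}
    (hf : Continuous fun θ => f (torusMap 0 r θ)) : TorusIntegrable f 0 r :=
  hf.continuousOn.integrableOn_compact isCompact_Icc

theorem iterInt_eq_torusIntegral {n : ℕ} {f : (Fin n → ℂ) → ℂ} {r : Fin n → ℝ}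
    (hf : Continuous fun θ => f (torusMap 0 r θ)) :
    iterInt n (fun i => fun g => ∮ z in C(0, r i), g z) f = torusIntegral f 0 r := by
  induction n with
  | zero => rw [torusIntegral_dim0, iterInt]; exact congrArg f (Subsingleton.elim _ _)
  | succ n ih =>
    rw [torusIntegral_succ (torusIntegrable_of_continuous hf), iterInt]
    refine intervalIntegral.integral_congr fun t _ => ?_
    simp only
    congr 1
    refine ih ?_
    convert hf.comp (show Continuous fun θ : Fin n → ℝ => (Fin.cons t θ : Fin (n + 1) → ℝ) by
      fun_prop) using 2 with θ
    simp only [Function.comp_apply]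
    congr 1
    ext i
    refine Fin.cases ?_ (fun i => ?_) i <;> simp [torusMap, circleMap]

/-- A torus integral vanishes if some one-variable integral vanishes identically. -/
theorem torusIntegral_eq_zero_of_circleIntegral {n : ℕ} {f : (Fin n → ℂ) → ℂ} {r : Fin n → ℝ}
    (hf : TorusIntegrable f 0 r) (i : Fin n)
    (h : ∀ θ, (∮ z in C(0, r i), f (Function.update (torusMap 0 r θ) i z)) = 0) :
    torusIntegral f 0 r = 0 := by
  obtain ⟨n, rfl⟩ : ∃ m, n = m + 1 := Nat.exists_eq_succ_of_ne_zero (by rintro rfl; exact i.elim0)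
  set e : ℝ × (Fin n → ℝ) ≃ᵐ (Fin (n + 1) → ℝ) :=
    (MeasurableEquiv.piFinSuccAbove (fun _ => ℝ) i).symm
  have hem : MeasurePreserving e :=
    (volume_preserving_piFinSuccAbove (fun _ : Fin (n + 1) => ℝ) i).symm _
  have heπ : (e ⁻¹' Set.Icc 0 fun _ => 2 * Real.pi) =
      Set.Icc 0 (2 * Real.pi) ×ˢ Set.Icc (0 : Fin n → ℝ) fun _ => 2 * Real.pi :=
    ((Fin.insertNthOrderIso (fun _ => ℝ) i).preimage_Icc _ _).trans (Set.Icc_prod_eq _ _)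
  have hint := hf.function_integrable
  rw [← hem.integrableOn_comp_preimage e.measurableEmbedding, heπ] at hint
  rw [torusIntegral, ← hem.map_eq, setIntegral_map_equiv, heπ, Measure.volume_eq_prod,
    ← setIntegral_prod_swap]
  refine (setIntegral_prod _ hint.swap).trans ?_
  refine setIntegral_eq_zero_of_forall_eq_zero fun Θ _ => ?_
  have hΘ := h (e (0, Θ))
  rw [circleIntegral_def_Icc] at hΘ
  have hmap (t : ℝ) : Function.update (torusMap 0 r (e (0, Θ))) i (circleMap 0 (r i) t) =
      torusMap 0 r (e (t, Θ)) := by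
    ext j
    refine Fin.succAboveCases i ?_ (fun j => ?_) j <;>
      simp [e, torusMap, circleMap, MeasurableEquiv.piFinSuccAbove_symm_apply,
        Fin.insertNthEquiv]
  simp only [hmap, deriv_circleMap] at hΘ
  have hprod (t : ℝ) : (∏ j, (r j : ℂ) * Complex.exp (e (t, Θ) j * Complex.I) * Complex.I) =
      (∏ j : Fin n, (r (i.succAbove j) : ℂ) * Complex.exp (Θ j * Complex.I) * Complex.I) *
        (circleMap 0 (r i) t * Complex.I) := by
    rw [Fin.prod_univ_succAbove _ i, mul_comm]
    simp [e, circleMap, MeasurableEquiv.piFinSuccAbove_symm_apply, Fin.insertNthEquiv]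
  simp only [mul_smul] at hΘ
  simp only [Function.comp_apply, Prod.swap, hprod, mul_smul, integral_smul, hΘ, smul_zero]

end ContourIntegrals

section NestedCauchy

theorem iterInt_const_mul {n : ℕ} (r : Fin n → ℝ) (c : ℂ) (f : (Fin n → ℂ) → ℂ) :
    iterInt n (fun i => fun g => ∮ z in C(0, r i), g z) (fun u => c * f u) =
      c * iterInt n (fun i => fun g => ∮ z in C(0, r i), g z) f := by
  induction n with
  | zero => rfl
  | succ n ih =>
    simp only [iterInt, ih (fun i => r i.succ), circleIntegral.integral_const_mul]

theorem prod_range_div_telescope (s q z : ℂ) (m : ℕ) (h : ∀ i, z - s * q ^ i ≠ 0) :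
    ∏ i ∈ range m, (z - s * q ^ i) / (z - q * (s * q ^ i)) = (z - s) / (z - s * q ^ m) := by
  induction m with
  | zero => have := h 0; simp at this; simp [this]
  | succ m ih =>
    have h1 := h m
    have h2 := h (m + 1)
    have h3 : z - q * (s * q ^ m) = z - s * q ^ (m + 1) := by ring
    rw [prod_range_succ, ih, h3]
    field_simp

theorem norm_mul_pow_le {q s : ℂ} (hq : ‖q‖ < 1) (e : ℕ) : ‖s * q ^ e‖ ≤ ‖s‖ := by
  rw [norm_mul, norm_pow]
  exact mul_le_of_le_one_right (norm_nonneg _) (pow_le_one₀ (norm_nonneg _) hq.le)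

/-- Evaluation of a nested contour integral whose innermost contour only surrounds the pole at
`s`: within each level set of `f`, the variables are successively set to `s, s q, s q², …`. -/
theorem iterInt_nested_cauchy {q s : ℂ} (hq : ‖q‖ < 1) {n : ℕ} (f : Fin n → ℕ) {r : Fin n → ℝ}
    (hr : StrictAnti r) (hs : ∀ i, ‖s‖ < r i) (h : Fin n → ℂ → ℂ)
    (hh : ∀ j z, ‖z‖ ≤ r j → DifferentiableAt ℂ (h j) z) :
    iterInt n (fun i => fun g => ∮ z in C(0, r i), g z)
      (fun u => prodLT (fun i j => if f i = f j then (u i - u j) / (u i - q * u j) else 1) *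
        ∏ j, h j (u j) / (u j - s)) =
      (2 * (Real.pi : ℂ) * Complex.I) ^ n * ∏ j, h j (s * q ^ laterCount f j) := by
  induction n with
  | zero => simp [iterInt, prodLT]
  | succ n ih =>
    set f' : Fin n → ℕ := fun j => f j.succ with hf'
    have hr0 : 0 < r 0 := (norm_nonneg s).trans_lt (hs 0)
    have hinner (z : ℂ) (hz : ‖z‖ = r 0) :
        iterInt n (fun i => fun g => ∮ z in C(0, r i.succ), g z)
          (fun u => prodLT (fun i j => if f i = f j then
              ((Fin.cons z u : Fin (n + 1) → ℂ) i - (Fin.cons z u : Fin (n + 1) → ℂ) j) /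
              ((Fin.cons z u : Fin (n + 1) → ℂ) i - q * (Fin.cons z u : Fin (n + 1) → ℂ) j)
              else 1) *
            ∏ j, h j ((Fin.cons z u : Fin (n + 1) → ℂ) j) /
              ((Fin.cons z u : Fin (n + 1) → ℂ) j - s)) =
        ((2 * (Real.pi : ℂ) * Complex.I) ^ n * ∏ j, h (Fin.succ j) (s * q ^ laterCount f' j)) *
          (h 0 z / (z - s * q ^ laterCount f 0)) := by
      have hzne (w : ℂ) (hw : ‖w‖ < r 0) : z - w ≠ 0 := by
        intro h0
        rw [sub_eq_zero.1 h0] at hz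
        exact hw.ne hz
      have hpole (i : ℕ) : z - s * q ^ i ≠ 0 :=
        hzne _ ((norm_mul_pow_le hq i).trans_lt (hs 0))
      have hzs : z - s ≠ 0 := hzne _ (hs 0)
      have hIH := ih f' (r := fun i => r i.succ)
        (fun i j hij => hr (Fin.succ_lt_succ_iff.2 hij)) (fun i => hs _)
        (fun j w => h j.succ w * if f j.succ = f 0 then (z - w) / (z - q * w) else 1)
        (fun j w hw => by
          refine (hh _ _ hw).mul ?_
          split_ifs
          · refine DifferentiableAt.div (by fun_prop) (by fun_prop) (hzne _ ?_)
            rw [norm_mul]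
            calc ‖q‖ * ‖w‖ ≤ 1 * ‖w‖ := by gcongr
              _ ≤ r j.succ := by rwa [one_mul]
              _ < r 0 := hr (Fin.succ_pos j)
          · fun_prop)
      have hfun : (fun u : Fin n → ℂ => prodLT (fun i j => if f i = f j then
              ((Fin.cons z u : Fin (n + 1) → ℂ) i - (Fin.cons z u : Fin (n + 1) → ℂ) j) /
              ((Fin.cons z u : Fin (n + 1) → ℂ) i - q * (Fin.cons z u : Fin (n + 1) → ℂ) j)
              else 1) *
            ∏ j, h j ((Fin.cons z u : Fin (n + 1) → ℂ) j) /
              ((Fin.cons z u : Fin (n + 1) → ℂ) j - s)) =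
          fun u => (h 0 z / (z - s)) *
            (prodLT (fun i j => if f' i = f' j then (u i - u j) / (u i - q * u j) else 1) *
            ∏ j, (h j.succ (u j) * if f j.succ = f 0 then (z - u j) / (z - q * u j) else 1) /
              (u j - s)) := by
        funext u
        rw [prodLT_succ, Fin.prod_univ_succ]
        simp only [Fin.cons_zero, Fin.cons_succ, mul_div_right_comm, prod_mul_distrib,
          eq_comm (a := f 0)]
        ring
      rw [hfun, iterInt_const_mul, hIH, prod_mul_distrib,
        prod_laterCount_fiber f' (f 0) (fun e => (z - s * q ^ e) / (z - q * (s * q ^ e))),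
        prod_range_div_telescope s q z _ hpole, laterCount_zero]
      have := hpole (mult (fun j : Fin n => f j.succ) (f 0))
      simp only [hf']
      field_simp
    rw [iterInt, circleIntegral.integral_congr hr0.le
      (fun z hz => hinner z (by simpa using hz)), circleIntegral.integral_const_mul,
      Complex.circleIntegral_div_sub_of_differentiable_on_off_countable Set.countable_empty
        (by simpa using (norm_mul_pow_le hq _).trans_lt (hs 0))
        (fun z hz => (hh 0 z (by simpa using hz)).continuousAt.continuousWithinAt)
        (fun z hz => hh 0 z (by simpa using (Metric.ball_subset_closedBall hz.1))),
      Fin.prod_univ_succ]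
    simp only [laterCount_succ]
    ring

end NestedCauchy

section Vanishing

open Filter Topology

/-- The factor of the permuted integrand attached to the inversions of `τ`. -/
def inversionKernel (q : ℂ) {n : ℕ} (τ : Equiv.Perm (Fin n)) (u : Fin n → ℂ) : ℂ :=
  prodLT (fun i j => if τ i < τ j then 1 else -((u j - q * u i) / (u i - q * u j)))

/-- The one-variable factor of the integrand with exponents `a` and `b`. -/
def levelFactor (s : ℂ) (a b : ℕ) (z : ℂ) : ℂ :=
  1 / (1 - s * z) / (z - s) * (((z - s) / (1 - s * z)) ^ a * ((1 - s * z) / (z - s)) ^ b)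

theorem levelFactor_of_lt {s : ℂ} {a b : ℕ} (hab : a < b) {z : ℂ} (h1 : 1 - s * z ≠ 0)
    (h2 : z - s ≠ 0) :
    levelFactor s a b z = ((1 - s * z) / (z - s)) ^ (b - a - 1) * (1 / (z - s) ^ 2) := by
  obtain ⟨c, rfl⟩ := Nat.exists_eq_add_of_lt hab
  rw [levelFactor, show a + c + 1 - a - 1 = c by omega]
  simp only [div_pow, pow_add]
  field_simp

theorem levelFactor_of_gt {s : ℂ} {a b : ℕ} (hab : b < a) {z : ℂ} (h1 : 1 - s * z ≠ 0)
    (h2 : z - s ≠ 0) :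
    levelFactor s a b z = ((z - s) / (1 - s * z)) ^ (a - b - 1) * (1 / (1 - s * z) ^ 2) := by
  obtain ⟨c, rfl⟩ := Nat.exists_eq_add_of_lt hab
  rw [levelFactor, show b + c + 1 - b - 1 = c by omega]
  simp only [div_pow, pow_add]
  field_simp

theorem tendsto_div_sub_cobounded (a b c : ℂ) :
    Tendsto (fun z => (a + b * z) / (z - c)) (Bornology.cobounded ℂ) (𝓝 b) := by
  have h1 : Tendsto (fun z : ℂ => z - c) (Bornology.cobounded ℂ) (Bornology.cobounded ℂ) := by
    simp [sub_eq_add_neg]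
  have h2 := (tendsto_inv₀_cobounded.comp h1).const_mul (a + b * c) |>.const_add b
  rw [mul_zero, add_zero] at h2
  refine h2.congr' ?_
  filter_upwards [Bornology.eventually_ne_cobounded c] with z hz
  have : z - c ≠ 0 := sub_ne_zero.2 hz
  simp only [Function.comp_apply]
  field_simp
  ring

theorem sub_ne_zero_of_norm_lt {x y : ℂ} (h : ‖y‖ < ‖x‖) : x - y ≠ 0 := by
  intro h0
  rw [sub_eq_zero.1 h0] at h
  exact lt_irrefl _ h

theorem norm_mul_lt_of_lt {q w : ℂ} {ρ : ℝ} (hq : ‖q‖ < 1) (hw : ‖w‖ < ρ) : ‖q * w‖ < ρ := by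
  rw [norm_mul]
  exact (mul_le_of_le_one_left (norm_nonneg _) hq.le).trans_lt hw

theorem one_sub_mul_ne_zero {s z : ℂ} (h : ‖s‖ * ‖z‖ < 1) : 1 - s * z ≠ 0 :=
  sub_ne_zero_of_norm_lt (by simpa using h)

theorem prod_update_eq {n : ℕ} (g : Fin n → ℂ → ℂ) (u : Fin n → ℂ) (j : Fin n) (z : ℂ) :
    ∏ i, g i (Function.update u j z i) = g j z * ∏ i ∈ univ.erase j, g i (u i) := by
  rw [← mul_prod_erase univ _ (mem_univ j), Function.update_self]
  congr 1
  refine prod_congr rfl fun i hi => ?_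
  rw [Function.update_of_ne (ne_of_mem_erase hi)]

/-- If no inversion of `τ` has `j` as its smaller index, the contour of the `j`-th variable can be
shrunk to a point. -/
theorem circleIntegral_update_eq_zero_of_shrink {q s : ℂ} (hq : ‖q‖ < 1) {n : ℕ}
    {r : Fin n → ℝ} (hr : StrictAnti r) (hs : ∀ i, ‖s‖ < r i) (hs' : ∀ i, ‖s‖ * r i < 1)
    (τ : Equiv.Perm (Fin n)) (a b : Fin n → ℕ) (j : Fin n) (hτ : ∀ l, j < l → τ j < τ l)
    (hab : b j < a j) (u : Fin n → ℂ) (hu : ∀ i, ‖u i‖ = r i) :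
    (∮ z in C(0, r j), inversionKernel q τ (Function.update u j z) *
      ∏ i, levelFactor s (a i) (b i) (Function.update u j z i)) = 0 := by
  have hr0 (i : Fin n) : 0 < r i := (norm_nonneg s).trans_lt (hs i)
  have h1 (z : ℂ) (hz : ‖z‖ ≤ r j) : 1 - s * z ≠ 0 :=
    one_sub_mul_ne_zero ((mul_le_mul_of_nonneg_left hz (norm_nonneg s)).trans_lt (hs' j))
  have hcongr : (∮ z in C(0, r j), inversionKernel q τ (Function.update u j z) *
      ∏ i, levelFactor s (a i) (b i) (Function.update u j z i)) =
      ∮ z in C(0, r j), inversionKernel q τ (Function.update u j z) *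
        (((z - s) / (1 - s * z)) ^ (a j - b j - 1) * (1 / (1 - s * z) ^ 2) *
        ∏ i ∈ univ.erase j, levelFactor s (a i) (b i) (u i)) := by
    refine circleIntegral.integral_congr (hr0 j).le fun z hz => ?_
    have hz' : ‖z‖ = r j := by simpa using hz
    rw [prod_update_eq (fun i => levelFactor s (a i) (b i)), levelFactor_of_gt hab (h1 z hz'.le)
      (sub_ne_zero_of_norm_lt (by rw [hz']; exact hs j))]
  rw [hcongr]
  refine circleIntegral_eq_zero_of_differentiableAt (hr0 j).le fun z hz => ?_
  have h1z := h1 z hz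
  refine DifferentiableAt.mul ?_ ?_
  · unfold inversionKernel prodLT
    refine DifferentiableAt.fun_finsetProd fun p hp => ?_
    have hlt : p.1 < p.2 := by simpa using hp
    beta_reduce
    split_ifs with hp'
    · fun_prop
    have hne1 : p.1 ≠ j := by
      intro h
      rw [h] at hp' hlt
      exact hp' (hτ _ hlt)
    simp only [Function.update_of_ne hne1]
    by_cases hne2 : p.2 = j
    · simp only [hne2, Function.update_self]
      refine DifferentiableAt.neg (DifferentiableAt.div (by fun_prop) (by fun_prop)
        (sub_ne_zero_of_norm_lt ?_))
      rw [hu]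
      exact norm_mul_lt_of_lt hq (hz.trans_lt (hr (hne2 ▸ hlt)))
    · simp only [Function.update_of_ne hne2]
      fun_prop
  · refine DifferentiableAt.mul_const (DifferentiableAt.mul (DifferentiableAt.pow ?_ _) ?_) _
    · exact DifferentiableAt.div (by fun_prop) (by fun_prop) h1z
    · exact DifferentiableAt.div (by fun_prop) (by fun_prop) (pow_ne_zero 2 h1z)

/-- If no inversion of `τ` has `j` as its larger index, the contour of the `j`-th variable can be
expanded to infinity. -/
theorem circleIntegral_update_eq_zero_of_expand {q s : ℂ} (hq : ‖q‖ < 1) {n : ℕ}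
    {r : Fin n → ℝ} (hr : StrictAnti r) (hs : ∀ i, ‖s‖ < r i) (hs' : ∀ i, ‖s‖ * r i < 1)
    (τ : Equiv.Perm (Fin n)) (a b : Fin n → ℕ) (j : Fin n) (hτ : ∀ i, i < j → τ i < τ j)
    (hab : a j < b j) (u : Fin n → ℂ) (hu : ∀ i, ‖u i‖ = r i) :
    (∮ z in C(0, r j), inversionKernel q τ (Function.update u j z) *
      ∏ i, levelFactor s (a i) (b i) (Function.update u j z i)) = 0 := by
  have hr0 (i : Fin n) : 0 < r i := (norm_nonneg s).trans_lt (hs i)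
  have h2 (z : ℂ) (hz : r j ≤ ‖z‖) : z - s ≠ 0 :=
    sub_ne_zero_of_norm_lt ((hs j).trans_le hz)
  have hcongr : (∮ z in C(0, r j), inversionKernel q τ (Function.update u j z) *
      ∏ i, levelFactor s (a i) (b i) (Function.update u j z i)) =
      ∮ z in C(0, r j), inversionKernel q τ (Function.update u j z) *
        (((1 - s * z) / (z - s)) ^ (b j - a j - 1) * (1 / (z - s) ^ 2) *
        ∏ i ∈ univ.erase j, levelFactor s (a i) (b i) (u i)) := by
    refine circleIntegral.integral_congr (hr0 j).le fun z hz => ?_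
    have hz' : ‖z‖ = r j := by simpa using hz
    rw [prod_update_eq (fun i => levelFactor s (a i) (b i)), levelFactor_of_lt hab
      (one_sub_mul_ne_zero (by rw [hz']; exact hs' j)) (h2 z hz'.ge)]
  rw [hcongr]
  have hfactor (p : Fin n × Fin n) (hlt : p.1 < p.2) :
      (∃ c : ℂ, ∀ z, (if τ p.1 < τ p.2 then 1 else -((Function.update u j z p.2 -
        q * Function.update u j z p.1) /
          (Function.update u j z p.1 - q * Function.update u j z p.2))) = c) ∨
      (‖u p.2‖ < r j ∧ ∀ z, (if τ p.1 < τ p.2 then 1 else -((Function.update u j z p.2 -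
        q * Function.update u j z p.1) /
          (Function.update u j z p.1 - q * Function.update u j z p.2))) =
          -((u p.2 + (-q) * z) / (z - q * u p.2))) := by
    by_cases hp' : τ p.1 < τ p.2
    · exact Or.inl ⟨1, fun z => if_pos hp'⟩
    have hne2 : p.2 ≠ j := by
      intro h
      rw [h] at hp' hlt
      exact hp' (hτ _ hlt)
    simp only [if_neg hp', Function.update_of_ne hne2]
    by_cases hne1 : p.1 = j
    · refine Or.inr ⟨?_, fun z => ?_⟩
      · rw [hu]
        exact hr (hne1 ▸ hlt)
      · simp only [hne1, Function.update_self]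
        ring
    · exact Or.inl ⟨_, fun z => by simp only [Function.update_of_ne hne1]; rfl⟩
  refine circleIntegral_eq_zero_of_tendsto_cobounded (hr0 j) (fun z hz => ?_) ?_
  · have h2z := h2 z hz
    refine DifferentiableAt.mul ?_ ?_
    · unfold inversionKernel prodLT
      refine DifferentiableAt.fun_finsetProd fun p hp => ?_
      rcases hfactor p (by simpa using hp) with ⟨c, hc⟩ | ⟨hup, hc⟩
      · simp only [hc]
        fun_prop
      · simp only [hc]
        refine DifferentiableAt.neg (DifferentiableAt.div (by fun_prop) (by fun_prop)
          (sub_ne_zero_of_norm_lt ?_))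
        exact norm_mul_lt_of_lt hq (hup.trans_le hz)
    · refine DifferentiableAt.mul_const (DifferentiableAt.mul (DifferentiableAt.pow ?_ _) ?_) _
      · exact DifferentiableAt.div (by fun_prop) (by fun_prop) h2z
      · exact DifferentiableAt.div (by fun_prop) (by fun_prop) (pow_ne_zero 2 h2z)
  · have hker : ∃ c, Tendsto (fun z => inversionKernel q τ (Function.update u j z))
        (Bornology.cobounded ℂ) (𝓝 c) := by
      have (p : Fin n × Fin n) : ∃ c : ℂ, p.1 < p.2 →
          Tendsto (fun z => if τ p.1 < τ p.2 then 1 else -((Function.update u j z p.2 -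
            q * Function.update u j z p.1) /
              (Function.update u j z p.1 - q * Function.update u j z p.2)))
            (Bornology.cobounded ℂ) (𝓝 c) := by
        by_cases hlt : p.1 < p.2
        · rcases hfactor p hlt with ⟨c, hc⟩ | ⟨-, hc⟩
          · exact ⟨c, fun _ => by simpa only [hc] using tendsto_const_nhds⟩
          · exact ⟨_, fun _ => by
              simpa only [hc] using (tendsto_div_sub_cobounded _ _ _).neg⟩
        · exact ⟨0, fun h => absurd h hlt⟩
      choose c hc using this
      exact ⟨_, tendsto_finsetProd _ fun p hp => hc p (by simpa using hp)⟩
    obtain ⟨c, hc⟩ := hker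
    have hψ : Tendsto (fun z : ℂ => (1 - s * z) / (z - s)) (Bornology.cobounded ℂ) (𝓝 (-s)) := by
      simpa [sub_eq_add_neg] using tendsto_div_sub_cobounded 1 (-s) s
    have h1 : Tendsto (fun z : ℂ => z / (z - s)) (Bornology.cobounded ℂ) (𝓝 1) := by
      simpa using tendsto_div_sub_cobounded 0 1 s
    have h0 : Tendsto (fun z : ℂ => 1 / (z - s)) (Bornology.cobounded ℂ) (𝓝 0) := by
      simpa using tendsto_div_sub_cobounded 1 0 s
    have := (hc.mul (((hψ.pow (b j - a j - 1)).mul (h1.mul h0)).mul_const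
      (∏ i ∈ univ.erase j, levelFactor s (a i) (b i) (u i))))
    simp only [mul_zero, zero_mul] at this
    refine this.congr fun z => ?_
    rw [← one_div_pow, div_eq_mul_one_div z]
    generalize 1 / (z - s) = w
    ring

theorem continuous_inversionKernel_levelFactor {q s : ℂ} (hq : ‖q‖ < 1) {n : ℕ}
    {r : Fin n → ℝ} (hr : StrictAnti r) (hs : ∀ i, ‖s‖ < r i) (hs' : ∀ i, ‖s‖ * r i < 1)
    (τ : Equiv.Perm (Fin n)) (a b : Fin n → ℕ) :
    Continuous fun θ => inversionKernel q τ (torusMap 0 r θ) *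
      ∏ i, levelFactor s (a i) (b i) (torusMap 0 r θ i) := by
  have hr0 (i : Fin n) : 0 < r i := (norm_nonneg s).trans_lt (hs i)
  have hc (i : Fin n) : Continuous fun θ => torusMap 0 r θ i :=
    (continuous_apply i).comp (continuous_torusMap 0 r)
  have h1 (i : Fin n) (θ : Fin n → ℝ) : 1 - s * torusMap 0 r θ i ≠ 0 :=
    one_sub_mul_ne_zero (by rw [norm_torusMap_zero hr0]; exact hs' i)
  have h2 (i : Fin n) (θ : Fin n → ℝ) : torusMap 0 r θ i - s ≠ 0 :=
    sub_ne_zero_of_norm_lt (by rw [norm_torusMap_zero hr0]; exact hs i)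
  refine Continuous.mul ?_ ?_
  · unfold inversionKernel prodLT
    refine continuous_finsetProd _ fun p hp => ?_
    have hlt : p.1 < p.2 := by simpa using hp
    beta_reduce
    split_ifs
    · exact continuous_const
    · refine (Continuous.div (by fun_prop) (by fun_prop) fun θ => ?_).neg
      refine sub_ne_zero_of_norm_lt ?_
      rw [norm_torusMap_zero hr0]
      exact norm_mul_lt_of_lt hq (by rw [norm_torusMap_zero hr0]; exact hr hlt)
  · refine continuous_finsetProd _ fun i _ => ?_
    unfold levelFactor
    have := hc i
    refine ((Continuous.div (by fun_prop) (by fun_prop) (h1 i)).div (by fun_prop) (h2 i)).mul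
      (((Continuous.div (by fun_prop) (by fun_prop) (h1 i)).pow _).mul
      ((Continuous.div (by fun_prop) (by fun_prop) (h2 i)).pow _))

theorem torusIntegral_eq_zero_of_ne {q s : ℂ} (hq : ‖q‖ < 1) {n : ℕ}
    {r : Fin n → ℝ} (hr : StrictAnti r) (hs : ∀ i, ‖s‖ < r i) (hs' : ∀ i, ‖s‖ * r i < 1)
    (τ : Equiv.Perm (Fin n)) {a b : Fin n → ℕ} (ha : Antitone a) (hb : Antitone b)
    (hne : a ∘ τ ≠ b) :
    torusIntegral (fun u => inversionKernel q τ u *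
      ∏ i, levelFactor s (a (τ i)) (b i) (u i)) 0 r = 0 := by
  have hr0 (i : Fin n) : 0 < r i := (norm_nonneg s).trans_lt (hs i)
  have hint : TorusIntegrable (fun u => inversionKernel q τ u *
      ∏ i, levelFactor s (a (τ i)) (b i) (u i)) 0 r :=
    torusIntegrable_of_continuous
      (continuous_inversionKernel_levelFactor hq hr hs hs' τ (a ∘ τ) b)
  by_contra h0
  refine hne (funext fun j => le_antisymm ?_ ?_)
  · obtain ⟨i, hi, hmin⟩ := exists_min_image (Ici j) τ ⟨j, mem_Ici.2 le_rfl⟩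
    rw [mem_Ici] at hi
    have hrec (l : Fin n) (hl : i < l) : τ i < τ l :=
      lt_of_le_of_ne (hmin l (mem_Ici.2 (hi.trans hl.le))) fun e => hl.ne (τ.injective e)
    have hi' : a (τ i) ≤ b i := by
      by_contra! hab
      exact h0 (torusIntegral_eq_zero_of_circleIntegral hint i fun θ =>
        circleIntegral_update_eq_zero_of_shrink hq hr hs hs' τ (a ∘ τ) b i hrec hab _
          (norm_torusMap_zero hr0 θ))
    exact (ha (hmin j (mem_Ici.2 le_rfl))).trans (hi'.trans (hb hi))
  · obtain ⟨i, hi, hmax⟩ := exists_max_image (Iic j) τ ⟨j, mem_Iic.2 le_rfl⟩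
    rw [mem_Iic] at hi
    have hrec (l : Fin n) (hl : l < i) : τ l < τ i :=
      lt_of_le_of_ne (hmax l (mem_Iic.2 (hl.le.trans hi))) fun e => hl.ne (τ.injective e)
    have hi' : b i ≤ a (τ i) := by
      by_contra! hab
      exact h0 (torusIntegral_eq_zero_of_circleIntegral hint i fun θ =>
        circleIntegral_update_eq_zero_of_expand hq hr hs hs' τ (a ∘ τ) b i hrec hab _
          (norm_torusMap_zero hr0 θ))
    exact (hb hi).trans (hi'.trans (ha (hmax j (mem_Iic.2 le_rfl))))

end Vanishing

section Orthogonality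

theorem prodLT_mul_prodLT_perm {q : ℂ} {n : ℕ} {u : Fin n → ℂ} (hu : ∀ i j, i < j → u i ≠ u j)
    (hqu : ∀ i j, i < j → u i ≠ q * u j) (σ : Equiv.Perm (Fin n)) :
    prodLT (fun i j => (u i - u j) / (u i - q * u j)) *
      prodLT (fun i j => (u (σ i) - q * u (σ j)) / (u (σ i) - u (σ j))) =
      inversionKernel q σ.symm u := by
  rw [prodLT_perm σ (fun i j => (u i - q * u j) / (u i - u j)), ← prodLT_mul, inversionKernel]
  refine prodLT_congr fun i j hij => ?_
  have h1 : u i - u j ≠ 0 := sub_ne_zero.2 (hu i j hij)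
  have h2 : u i - q * u j ≠ 0 := sub_ne_zero.2 (hqu i j hij)
  split_ifs
  · rw [div_mul_div_cancel₀ h2, div_self h1]
  · rw [← neg_sub (u i) (u j)]
    field_simp

theorem prodLT_mul_Ffun_mul_prod {q : ℂ} (s : ℂ) {n : ℕ} {u : Fin n → ℂ}
    (hu : ∀ i j, i < j → u i ≠ u j) (hqu : ∀ i j, i < j → u i ≠ q * u j) (a b : Fin n → ℕ) :
    prodLT (fun i j => (u i - u j) / (u i - q * u j)) * Ffun q s a u *
      (∏ i, (1 / (u i - s) * ((1 - s * u i) / (u i - s)) ^ b i)) =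
      (1 - q) ^ n * ∑ σ : Equiv.Perm (Fin n), inversionKernel q σ.symm u *
        ∏ i, levelFactor s (a (σ.symm i)) (b i) (u i) := by
  simp only [Ffun, mul_sum, sum_mul]
  refine sum_congr rfl fun σ _ => ?_
  rw [← prodLT_mul_prodLT_perm hu hqu σ, ← Equiv.prod_comp σ.symm
    fun i => ((u (σ i) - s) / (1 - s * u (σ i))) ^ a i]
  simp only [Equiv.apply_symm_apply, levelFactor, prod_mul_distrib, prod_div_distrib,
    prod_const_one, prodLT]
  ring

theorem sum_stabilizer_inversionKernel {q s : ℂ} (hq : q ≠ 1) {n : ℕ} {f : Fin n → ℕ}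
    (hf : Antitone f) {u : Fin n → ℂ} (hu : Function.Injective u) (hu0 : ∀ i, u i ≠ 0)
    (hqu : ∀ i j, i < j → u i ≠ q * u j) (h1 : ∀ i, 1 - s * u i ≠ 0) (h2 : ∀ i, u i - s ≠ 0) :
    (∑ σ : Equiv.Perm (Fin n), if f ∘ σ.symm = f then inversionKernel q σ.symm u *
        ∏ i, levelFactor s (f (σ.symm i)) (f i) (u i) else 0) =
      (∏ j, (1 - q ^ (laterCount f j + 1)) / (1 - q)) *
        (prodLT (fun i j => if f i = f j then (u i - u j) / (u i - q * u j) else 1) *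
          ∏ j, 1 / (1 - s * u j) / (u j - s)) := by
  have hlt (i j : Fin n) (h : i < j) : u i ≠ u j := fun e => h.ne (hu e)
  have hterm (σ : Equiv.Perm (Fin n)) : (if f ∘ σ.symm = f then inversionKernel q σ.symm u *
        ∏ i, levelFactor s (f (σ.symm i)) (f i) (u i) else 0) =
      prodLT (fun i j => (u i - u j) / (u i - q * u j)) *
        (∏ j, 1 / (1 - s * u j) / (u j - s)) * if f ∘ σ = f then
          prodLT (fun i j => (u (σ i) - q * u (σ j)) / (u (σ i) - u (σ j))) else 0 := by
    have hiff : f ∘ σ.symm = f ↔ f ∘ σ = f := by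
      rw [Equiv.comp_symm_eq, eq_comm]
    by_cases h : f ∘ σ = f
    · rw [if_pos h, if_pos (hiff.2 h), ← prodLT_mul_prodLT_perm hlt hqu σ, mul_right_comm]
      congr 2
      refine prod_congr rfl fun i _ => ?_
      have h1i := h1 i
      have h2i := h2 i
      rw [show f (σ.symm i) = f i from congrFun (hiff.2 h) i, levelFactor, ← mul_pow]
      rw [div_mul_div_cancel₀ h1i, div_self h2i, one_pow, mul_one]
    · rw [if_neg h, if_neg (mt hiff.1 h), mul_zero]
  simp only [hterm]
  rw [← mul_sum, sum_stabilizer_prodLT q hq f hf u hu hu0]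
  have hcross : prodLT (fun i j => (u i - u j) / (u i - q * u j)) *
      (∏ i, ∏ j, if f j < f i then (u i - q * u j) / (u i - u j) else 1) =
      prodLT (fun i j => if f i = f j then (u i - u j) / (u i - q * u j) else 1) := by
    have := prod_ite_lt_eq_prodLT (fun i => OrderDual.toDual (f i))
      (fun i j => (u i - q * u j) / (u i - u j))
    simp only [OrderDual.toDual_lt_toDual] at this
    rw [this, ← prodLT_mul]
    refine prodLT_congr fun i j hij => ?_
    have hi : u i - u j ≠ 0 := sub_ne_zero.2 (hlt i j hij)
    have hj : u i - q * u j ≠ 0 := sub_ne_zero.2 (hqu i j hij)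
    rcases (hf hij.le).lt_or_eq with h | h
    · rw [if_pos h, if_neg h.not_gt, if_neg h.ne', mul_one, div_mul_div_cancel₀ hj,
        div_self hi]
    · simp [h]
  rw [← hcross]
  ring

theorem torusIntegral_sum {ι : Type*} (S : Finset ι) {n : ℕ} {r : Fin n → ℝ}
    {f : ι → (Fin n → ℂ) → ℂ} (hf : ∀ i ∈ S, TorusIntegrable (f i) 0 r) :
    torusIntegral (fun u => ∑ i ∈ S, f i u) 0 r = ∑ i ∈ S, torusIntegral (f i) 0 r := by
  simp only [torusIntegral, smul_sum]
  exact MeasureTheory.integral_finsetSum _ fun i hi => (hf i hi).function_integrable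

theorem torusIntegral_congr_of_norm {n : ℕ} {r : Fin n → ℝ} (hr : ∀ i, 0 < r i)
    {f g : (Fin n → ℂ) → ℂ} (h : ∀ u, (∀ i, ‖u i‖ = r i) → f u = g u) :
    torusIntegral f 0 r = torusIntegral g 0 r := by
  simp only [torusIntegral, h _ (norm_torusMap_zero hr _)]

theorem iterInt_orthogonality {q s : ℂ} (hq : ‖q‖ < 1) {n : ℕ} {r : Fin n → ℝ}
    (hr : StrictAnti r) (hs : ∀ i, ‖s‖ < r i) (hs' : ∀ i, ‖s‖ * r i < 1) {a b : Fin n → ℕ}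
    (ha : Antitone a) (hb : Antitone b) :
    iterInt n (fun i => fun g => ∮ z in C(0, r i), g z)
      (fun u => prodLT (fun i j => (u i - u j) / (u i - q * u j)) * Fc q s a u *
        ∏ i, (1 / (u i - s) * ((1 - s * u i) / (u i - s)) ^ b i)) =
      if a = b then (2 * Real.pi * Complex.I) ^ n else 0 := by
  have hr0 (i : Fin n) : 0 < r i := (norm_nonneg s).trans_lt (hs i)
  have hq1 : q ≠ 1 := by rintro rfl; simp at hq
  have hinj (u : Fin n → ℂ) (hu : ∀ i, ‖u i‖ = r i) : Function.Injective u := fun i j e =>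
    hr.injective (by rw [← hu, ← hu, e])
  have hlt (u : Fin n → ℂ) (hu : ∀ i, ‖u i‖ = r i) (i j : Fin n) (h : i < j) : u i ≠ u j :=
    fun e => h.ne (hinj u hu e)
  have hqlt (u : Fin n → ℂ) (hu : ∀ i, ‖u i‖ = r i) (i j : Fin n) (h : i < j) :
      u i ≠ q * u j := by
    refine sub_ne_zero.1 (sub_ne_zero_of_norm_lt ?_)
    rw [hu]
    exact norm_mul_lt_of_lt hq (by rw [hu]; exact hr h)
  have h1 (u : Fin n → ℂ) (hu : ∀ i, ‖u i‖ = r i) (i : Fin n) : 1 - s * u i ≠ 0 :=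
    one_sub_mul_ne_zero (by rw [hu]; exact hs' i)
  have h2 (u : Fin n → ℂ) (hu : ∀ i, ‖u i‖ = r i) (i : Fin n) : u i - s ≠ 0 :=
    sub_ne_zero_of_norm_lt (by rw [hu]; exact hs i)
  set T : Equiv.Perm (Fin n) → (Fin n → ℂ) → ℂ := fun σ u => inversionKernel q σ.symm u *
    ∏ i, levelFactor s (a (σ.symm i)) (b i) (u i)
  have hTc (σ : Equiv.Perm (Fin n)) : Continuous fun θ => T σ (torusMap 0 r θ) :=
    continuous_inversionKernel_levelFactor hq hr hs hs' σ.symm (a ∘ σ.symm) b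
  have hint : ∀ u : Fin n → ℂ, (∀ i, ‖u i‖ = r i) →
      prodLT (fun i j => (u i - u j) / (u i - q * u j)) * Fc q s a u *
        (∏ i, (1 / (u i - s) * ((1 - s * u i) / (u i - s)) ^ b i)) =
      cconst q s a * (1 - q) ^ n * ∑ σ, T σ u := fun u hu => by
    rw [mul_assoc (cconst q s a), ← prodLT_mul_Ffun_mul_prod s (hlt u hu) (hqlt u hu) a b, Fc]
    ring
  rw [iterInt_eq_torusIntegral, torusIntegral_congr_of_norm hr0 hint, torusIntegral_const_mul,
    torusIntegral_sum _ fun σ _ => torusIntegrable_of_continuous (hTc σ)]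
  swap
  · simp only [hint _ (norm_torusMap_zero hr0 _)]
    exact continuous_const.mul (continuous_finsetSum _ fun σ _ => hTc σ)
  have hzero (σ : Equiv.Perm (Fin n)) (hne : a ∘ σ.symm ≠ b) : torusIntegral (T σ) 0 r = 0 :=
    torusIntegral_eq_zero_of_ne hq hr hs hs' σ.symm ha hb hne
  split_ifs with hab
  · subst hab
    have hsum : ∑ σ, torusIntegral (T σ) 0 r =
        torusIntegral (fun u => ∑ σ, if a ∘ σ.symm = a then T σ u else 0) 0 r := by
      rw [torusIntegral_sum]
      · refine sum_congr rfl fun σ _ => ?_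
        split_ifs with h
        · rfl
        · rw [hzero σ h]
          simp [torusIntegral]
      · intro σ _
        split_ifs
        · exact torusIntegrable_of_continuous (hTc σ)
        · exact torusIntegrable_of_continuous continuous_const
    rw [hsum, torusIntegral_congr_of_norm hr0 fun u hu => sum_stabilizer_inversionKernel hq1 ha
      (hinj u hu) (fun i => norm_pos_iff.1 (by rw [hu]; exact hr0 i)) (hqlt u hu) (h1 u hu)
      (h2 u hu), torusIntegral_const_mul, ← iterInt_eq_torusIntegral]
    · rw [iterInt_nested_cauchy hq a hr hs (fun _ z => 1 / (1 - s * z)) fun j z hz =>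
        DifferentiableAt.div (by fun_prop) (by fun_prop)
          (one_sub_mul_ne_zero ((mul_le_mul_of_nonneg_left hz (norm_nonneg s)).trans_lt (hs' j))),
        cconst_eq_prod, ← Fin.prod_const n (1 - q), ← prod_mul_distrib]
      rw [mul_left_comm, mul_comm (_ ^ n), ← mul_assoc, ← mul_assoc, ← prod_mul_distrib,
        ← prod_mul_distrib]
      refine (congrArg (· * _) (prod_eq_one fun j _ => ?_)).trans (one_mul _)
      have hqe : 1 - q ^ (laterCount a j + 1) ≠ 0 := sub_ne_zero_of_norm_lt (by
        rw [norm_pow, norm_one]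
        exact pow_lt_one₀ (norm_nonneg q) hq (Nat.succ_ne_zero _))
      have hse : 1 - s ^ 2 * q ^ laterCount a j ≠ 0 := by
        rw [sq, mul_assoc]
        refine one_sub_mul_ne_zero ((mul_le_mul_of_nonneg_left ?_ (norm_nonneg s)).trans_lt (hs' j))
        exact (norm_mul_pow_le hq _).trans (hs j).le
      have hq0 : 1 - q ≠ 0 := sub_ne_zero.2 hq1.symm
      rw [show s * (s * q ^ laterCount a j) = s ^ 2 * q ^ laterCount a j by ring]
      field_simp
    · have hc (i : Fin n) : Continuous fun θ => torusMap 0 r θ i :=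
        (continuous_apply i).comp (continuous_torusMap 0 r)
      refine Continuous.mul ?_ (continuous_finsetProd _ fun j _ => ?_)
      · unfold prodLT
        refine continuous_finsetProd _ fun p hp => ?_
        beta_reduce
        split_ifs
        · exact Continuous.div ((hc _).sub (hc _)) ((hc _).sub ((hc _).const_mul q)) fun θ =>
            sub_ne_zero.2 (hqlt _ (norm_torusMap_zero hr0 θ) _ _ (by simpa using hp))
        · exact continuous_const
      · exact (Continuous.div continuous_const (continuous_const.sub ((hc j).const_mul s))
          fun θ => h1 _ (norm_torusMap_zero hr0 θ) j).div ((hc j).sub continuous_const)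
          fun θ => h2 _ (norm_torusMap_zero hr0 θ) j
  · rw [sum_eq_zero fun σ _ => hzero σ fun h => hab ?_, mul_zero]
    have := Tuple.unique_antitone (f := a) (σ := 1) (τ := σ.symm) (by simpa using ha) (h ▸ hb)
    simpa [h] using this

end Orthogonality

/-- Theorem 7.4 (spatial orthogonality) with the q-nested contours realized as concentric
circles of strictly decreasing radii in `(|s|, |s|⁻¹)`. -/
theorem spatial_orthogonality (q s : ℝ) (hq : q ∈ Set.Ioo (0 : ℝ) 1)
    (hs : s ∈ Set.Ioo (-1 : ℝ) 0) (k : ℕ) (hk : 1 ≤ k)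
    (r : Fin k → ℝ) (hr : StrictAnti r) (hr1 : ∀ i, |s| < r i) (hr2 : ∀ i, r i < |s|⁻¹)
    (lam mu : Sign k) :
    (1 / (2 * (Real.pi : ℂ) * Complex.I)) ^ k *
      iterInt k (fun i => fun g => ∮ z in C(0, r i), g z)
        (fun u =>
          (∏ p ∈ (Finset.univ : Finset (Fin k × Fin k)).filter (fun p => p.1 < p.2),
            (u p.1 - u p.2) / (u p.1 - (q : ℂ) * u p.2)) *
          Fc (q : ℂ) (s : ℂ) lam.1 u *
          ∏ i, (1 / (u i - (s : ℂ)) * ((1 - (s : ℂ) * u i) / (u i - (s : ℂ))) ^ (mu.1 i)))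
      = if lam = mu then 1 else 0 := by
  have hsneg : 0 < |s| := abs_pos.2 hs.2.ne
  have hmain := iterInt_orthogonality (q := (q : ℂ)) (s := (s : ℂ))
    (by simpa [abs_of_pos hq.1] using hq.2) hr (by simpa using hr1)
    (fun i => by
      rw [Complex.norm_real, Real.norm_eq_abs, ← mul_inv_cancel₀ hsneg.ne']
      exact mul_lt_mul_of_pos_left (hr2 i) hsneg)
    (a := lam.1) (b := mu.1) (fun i j => lam.2 i j) (fun i j => mu.2 i j)
  simp only [prodLT] at hmain
  rw [hmain, mul_ite, mul_zero, ← mul_pow, one_div_mul_cancel Complex.two_pi_I_ne_zero, one_pow]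
  simp only [Subtype.ext_iff]

end
end
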